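/- For every real x > 0, dim_H 𝐔(x) = dim_H 𝐔_{q_x}, where Hausdorff dimension on {0,1,…,M}^ℕ is taken with respect to the metric ρ. -/

import Mathlib

open scoped ENNReal NNReal Classical

namespace Expansions

/-- Digit sequences over the alphabet `{0,1,…,M}`; index `i : ℕ` represents the
`(i+1)`-st digit `d_{i+1}` of the paper. -/
abbrev Digits (M : ℕ) := ℕ → Fin (M + 1)

/-- `π_q((d_i)) = Σ_{i≥1} d_i / q^i`. -/
noncomputable def piQ (M : ℕ) (q : ℝ) (d : Digits M) : ℝ :=
  ∑' i : ℕ, (d i : ℝ) / q ^ (i + 1)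

/-- `𝒰_q` : the set of real numbers having a unique `q`-expansion. -/
def Uq (M : ℕ) (q : ℝ) : Set ℝ := {x | ∃! d : Digits M, piQ M q d = x}

/-- `𝐔_q` : the set of sequences that are the unique `q`-expansion of their value. -/
def UqSym (M : ℕ) (q : ℝ) : Set (Digits M) :=
  {d | ∀ e : Digits M, piQ M q e = piQ M q d → e = d}

/-- `𝒰(x)` : the set of univoque bases of `x`. -/
def Ubases (M : ℕ) (x : ℝ) : Set ℝ :=
  {q | q ∈ Set.Ioc (1 : ℝ) ((M : ℝ) + 1) ∧ x ∈ Uq M q}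

/-- `q_x = min{M+1, 1+M/x}`. -/
noncomputable def qx (M : ℕ) (x : ℝ) : ℝ := min ((M : ℝ) + 1) (1 + (M : ℝ) / x)

/-- Strict lexicographic order on digit sequences. -/
def lexLt {M : ℕ} (c d : Digits M) : Prop := ∃ n, (∀ i < n, c i = d i) ∧ c n < d n

def lexLe {M : ℕ} (c d : Digits M) : Prop := c = d ∨ lexLt c d

/-- The sequence ends with `0^∞`. -/
def EndsInZero {M : ℕ} (d : Digits M) : Prop := ∃ N, ∀ n ≥ N, d n = 0

/-- `d` is the quasi-greedy `q`-expansion of `x`: the lexicographically largest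
`q`-expansion of `x` not ending with `0^∞`. -/
def IsQuasiGreedy (M : ℕ) (q x : ℝ) (d : Digits M) : Prop :=
  piQ M q d = x ∧ ¬ EndsInZero d ∧
    ∀ e : Digits M, piQ M q e = x → ¬ EndsInZero e → lexLe e d

/-- `Φ_x(q)`: the quasi-greedy `q`-expansion of `x` (junk value if none exists). -/
noncomputable def Phi (M : ℕ) (x q : ℝ) : Digits M :=
  if h : ∃ d : Digits M, IsQuasiGreedy M q x d then h.choose else fun _ => 0

/-- `𝐔(x) = {Φ_x(q) : q ∈ 𝒰(x)}`. -/
def UxSym (M : ℕ) (x : ℝ) : Set (Digits M) := (Phi M x) '' (Ubases M x)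

/-- `ρ((c_i),(d_i)) = (M+1)^{-inf{i ≥ 1 : c_i ≠ d_i}}` (our index `n` represents the
`(n+1)`-st digit, whence the exponent `-(n+1)`); `ρ(c,c) = 0`. -/
noncomputable def rho (M : ℕ) (c d : Digits M) : ℝ :=
  if c = d then 0
  else ((M : ℝ) + 1) ^ (-(((sInf {i | c i ≠ d i} : ℕ) : ℤ) + 1))

/-- Diameter of a set with respect to a distance function, valued in `ℝ≥0∞`. -/
noncomputable def gdiam {X : Type*} (dist : X → X → ℝ) (A : Set X) : ℝ≥0∞ :=
  ⨆ x ∈ A, ⨆ y ∈ A, ENNReal.ofReal (dist x y)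

/-- The `s`-dimensional Hausdorff outer measure with respect to a distance function:
`lim_{δ→0⁺} inf {Σ diam(C n)^s : A ⊆ ⋃ C n, diam (C n) ≤ δ}`. -/
noncomputable def gHMeasure {X : Type*} (dist : X → X → ℝ) (s : ℝ) (A : Set X) : ℝ≥0∞ :=
  ⨆ (δ : ℝ) (_ : 0 < δ),
    ⨅ (C : ℕ → Set X) (_ : A ⊆ ⋃ n, C n)
      (_ : ∀ n, gdiam dist (C n) ≤ ENNReal.ofReal δ),
      ∑' n, gdiam dist (C n) ^ s

/-- Hausdorff dimension with respect to a distance function. -/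
noncomputable def gdimH {X : Type*} (dist : X → X → ℝ) (A : Set X) : ℝ≥0∞ :=
  ⨆ (s : ℝ≥0) (_ : gHMeasure dist (s : ℝ) A = ⊤), (s : ℝ≥0∞)

/-- The generalized golden ratio `q_G`. -/
noncomputable def qG (M : ℕ) : ℝ :=
  if M % 2 = 0 then ((M / 2 : ℕ) : ℝ) + 1
  else (((M / 2 : ℕ) : ℝ) + 1 +
    Real.sqrt (((M / 2 : ℕ) : ℝ) ^ 2 + 6 * ((M / 2 : ℕ) : ℝ) + 5)) / 2

/-- `x_G = M/(q_G - 1)`. -/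
noncomputable def xG (M : ℕ) : ℝ := (M : ℝ) / (qG M - 1)

/-- The Komornik–Loreti constant `q_KL = min 𝒰(1)`. -/
noncomputable def qKL (M : ℕ) : ℝ := sInf (Ubases M 1)

/-- `x_KL = M/(q_KL - 1)`. -/
noncomputable def xKL (M : ℕ) : ℝ := (M : ℝ) / (qKL M - 1)

/-- `X_iso`: the set of `x > 0` such that `𝒰(x)` contains an isolated point. -/
def Xiso (M : ℕ) : Set ℝ :=
  {x | 0 < x ∧ ∃ q ∈ Ubases M x, ∃ ε > 0, Ubases M x ∩ Set.Ioo (q - ε) (q + ε) = {q}}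

/-- The bifurcation set `𝒱 = {q ∈ (1,M+1] : 𝐔_r ≠ 𝐔_q for all r > q}`. -/
def Vset (M : ℕ) : Set ℝ :=
  {q | q ∈ Set.Ioc (1 : ℝ) ((M : ℝ) + 1) ∧
    ∀ r ∈ Set.Ioc (1 : ℝ) ((M : ℝ) + 1), q < r → UqSym M r ≠ UqSym M q}

/-- The Thue–Morse sequence `τ_i` = parity of the binary digit sum of `i`. -/
def tm (i : ℕ) : ℕ := (Nat.digits 2 i).sum % 2


section

variable {M : ℕ}

/-! ### Words, shifts and cylinders -/

/-- Prepend a digit to a sequence. -/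
def cons (a : Fin (M + 1)) (y : Digits M) : Digits M
  | 0 => a
  | n + 1 => y n

/-- The shift by `n` places. -/
def sh (n : ℕ) (d : Digits M) : Digits M := fun i => d (i + n)

/-- Prepend a finite word to a sequence. -/
def cat : List (Fin (M + 1)) → Digits M → Digits M
  | [], y => y
  | a :: w, y => cons a (cat w y)

/-- The word formed by the first `n` digits. -/
def pre : ℕ → Digits M → List (Fin (M + 1))
  | 0, _ => []
  | n + 1, d => d 0 :: pre n (sh 1 d)

/-- The cylinder set of a word. -/
def cyl (w : List (Fin (M + 1))) : Set (Digits M) := Set.range (cat w)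

/-- The digitwise reflection `d ↦ M - d`. -/
def compl (d : Digits M) : Digits M := fun i => (d i).rev

@[simp] lemma cons_zero (a : Fin (M + 1)) (y : Digits M) : cons a y 0 = a := rfl
@[simp] lemma cons_succ (a : Fin (M + 1)) (y : Digits M) (n : ℕ) : cons a y (n + 1) = y n := rfl
@[simp] lemma sh_zero (d : Digits M) : sh 0 d = d := rfl
lemma sh_apply (n : ℕ) (d : Digits M) (i : ℕ) : sh n d i = d (i + n) := rfl
lemma sh_sh (m n : ℕ) (d : Digits M) : sh m (sh n d) = sh (m + n) d := by
  funext i; simp [sh_apply, add_assoc]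
@[simp] lemma sh_one_cons (a : Fin (M + 1)) (y : Digits M) : sh 1 (cons a y) = y := rfl
lemma sh_succ_cons (n : ℕ) (a : Fin (M + 1)) (y : Digits M) :
    sh (n + 1) (cons a y) = sh n y := rfl
@[simp] lemma cons_sh_one (d : Digits M) : cons (d 0) (sh 1 d) = d := by
  funext i; cases i <;> rfl
@[simp] lemma cat_nil (y : Digits M) : cat [] y = y := rfl
@[simp] lemma cat_cons (a : Fin (M + 1)) (w : List (Fin (M + 1))) (y : Digits M) :
    cat (a :: w) y = cons a (cat w y) := rfl
lemma cat_append (u w : List (Fin (M + 1))) (y : Digits M) :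
    cat (u ++ w) y = cat u (cat w y) := by
  induction u with
  | nil => rfl
  | cons a u ih => simp [ih]
@[simp] lemma compl_cons (a : Fin (M + 1)) (y : Digits M) :
    compl (cons a y) = cons a.rev (compl y) := by
  funext i; cases i <;> rfl
lemma sh_compl (n : ℕ) (d : Digits M) : sh n (compl d) = compl (sh n d) := rfl
@[simp] lemma compl_compl (d : Digits M) : compl (compl d) = d := by
  funext i; simp [compl]

lemma cons_injective {a b : Fin (M + 1)} {y z : Digits M} (h : cons a y = cons b z) :
    a = b ∧ y = z :=
  ⟨congrFun h 0, by funext i; exact congrFun h (i + 1)⟩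

lemma cat_injective (w : List (Fin (M + 1))) : Function.Injective (cat w) := by
  induction w with
  | nil => exact fun _ _ h => h
  | cons a w ih => exact fun y z h => ih (cons_injective h).2

@[simp] lemma length_pre (n : ℕ) (d : Digits M) : (pre n d).length = n := by
  induction n generalizing d with
  | zero => rfl
  | succ n ih => simp [pre, ih]

lemma cat_pre (n : ℕ) (d : Digits M) : cat (pre n d) (sh n d) = d := by
  induction n generalizing d with
  | zero => rfl
  | succ n ih =>
    have := ih (sh 1 d)
    rw [sh_sh] at this
    simp [pre, this]

lemma pre_cat (w : List (Fin (M + 1))) (y : Digits M) : pre w.length (cat w y) = w := by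
  induction w with
  | nil => rfl
  | cons a w ih => simp [pre, ih]

lemma sh_cat (w : List (Fin (M + 1))) (y : Digits M) : sh w.length (cat w y) = y := by
  induction w with
  | nil => rfl
  | cons a w ih => simpa [sh_succ_cons] using ih

lemma mem_cyl_iff {w : List (Fin (M + 1))} {d : Digits M} :
    d ∈ cyl w ↔ pre w.length d = w := by
  constructor
  · rintro ⟨y, rfl⟩; exact pre_cat w y
  · intro h; exact ⟨sh w.length d, by conv_rhs => rw [← cat_pre w.length d, h]⟩

lemma pre_add (m n : ℕ) (d : Digits M) : pre (m + n) d = pre m d ++ pre n (sh m d) := by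
  induction m generalizing d with
  | zero => simp [pre]
  | succ m ih =>
    rw [Nat.add_right_comm]
    simp [pre, ih, sh_sh]

lemma pre_eq_of_le {m n : ℕ} (h : m ≤ n) {d e : Digits M} (he : pre n d = pre n e) :
    pre m d = pre m e := by
  obtain ⟨k, rfl⟩ := Nat.exists_eq_add_of_le h
  rw [pre_add, pre_add] at he
  exact (List.append_inj he (by simp)).1

lemma pre_eq_iff {n : ℕ} {d e : Digits M} : pre n d = pre n e ↔ ∀ i < n, d i = e i := by
  induction n generalizing d e with
  | zero => simp [pre]
  | succ n ih =>
    simp only [pre, List.cons.injEq, ih, sh_apply]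
    constructor
    · rintro ⟨h0, h⟩ i hi
      cases i with
      | zero => exact h0
      | succ i => exact h i (by omega)
    · exact fun h => ⟨h 0 (by omega), fun i hi => h (i + 1) (by omega)⟩

lemma cat_mem_cyl (w : List (Fin (M + 1))) (y : Digits M) : cat w y ∈ cyl w := ⟨y, rfl⟩

/-! ### The value map -/

lemma digit_le (a : Fin (M + 1)) : (a : ℝ) ≤ M := by
  exact_mod_cast Nat.lt_succ_iff.mp a.2

lemma rev_cast (a : Fin (M + 1)) : ((a.rev : Fin (M + 1)) : ℝ) = M - (a : ℝ) := by
  rw [Fin.val_rev]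
  have : (a : ℕ) ≤ M := Nat.lt_succ_iff.mp a.2
  rw [Nat.add_sub_add_right]
  push_cast [this]; ring

lemma hasSum_geom {q : ℝ} (hq : 1 < q) : HasSum (fun i : ℕ => (M : ℝ) / q ^ (i + 1))
    (M / (q - 1)) := by
  have h0 : 0 < q := by linarith
  have := (hasSum_geometric_of_lt_one (inv_nonneg.2 h0.le) (inv_lt_one_of_one_lt₀ hq)).mul_left
    ((M : ℝ) / q)
  have h1 : q - 1 ≠ 0 := by linarith
  have e1 : (M : ℝ) / q * (1 - q⁻¹)⁻¹ = M / (q - 1) := by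
    have : (1 - q⁻¹) = (q - 1) / q := by field_simp
    rw [this]; field_simp
  rw [e1] at this
  refine this.congr_fun fun i => ?_
  rw [inv_pow, pow_succ]; field_simp

lemma summable_piQ {q : ℝ} (hq : 1 < q) (d : Digits M) :
    Summable (fun i : ℕ => (d i : ℝ) / q ^ (i + 1)) := by
  have h0 : 0 < q := by linarith
  refine Summable.of_nonneg_of_le (fun i => by positivity) (fun i => ?_)
    (hasSum_geom (M := M) hq).summable
  exact div_le_div_of_nonneg_right (digit_le _) (by positivity)

lemma piQ_nonneg {q : ℝ} (hq : 1 < q) (d : Digits M) : 0 ≤ piQ M q d := by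
  have h0 : 0 < q := by linarith
  exact tsum_nonneg fun i => by positivity

lemma piQ_cons {q : ℝ} (hq : 1 < q) (a : Fin (M + 1)) (y : Digits M) :
    piQ M q (cons a y) = (a + piQ M q y) / q := by
  have h0 : 0 < q := by linarith
  unfold piQ
  rw [(summable_piQ hq (cons a y)).tsum_eq_zero_add, add_div, ← tsum_div_const]
  simp only [cons_zero, cons_succ, zero_add, pow_one]
  congr 1
  refine tsum_congr fun i => ?_
  rw [pow_succ q (i + 1), div_div]

lemma piQ_eq_head {q : ℝ} (hq : 1 < q) (d : Digits M) :
    piQ M q d = (d 0 + piQ M q (sh 1 d)) / q := by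
  conv_lhs => rw [← cons_sh_one d]
  exact piQ_cons hq _ _

lemma piQ_compl {q : ℝ} (hq : 1 < q) (d : Digits M) :
    piQ M q (compl d) = M / (q - 1) - piQ M q d := by
  have h := (hasSum_geom (M := M) hq).sub (summable_piQ hq d).hasSum
  have h' : (M : ℝ) / (q - 1) - piQ M q d = _ := h.tsum_eq.symm
  rw [h']
  refine tsum_congr fun i => ?_
  rw [compl, rev_cast, sub_div]

lemma piQ_le {q : ℝ} (hq : 1 < q) (d : Digits M) : piQ M q d ≤ M / (q - 1) := by
  have := piQ_nonneg hq (compl d)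
  rw [piQ_compl hq] at this
  linarith

lemma piQ_cat_sub {q : ℝ} (hq : 1 < q) (w : List (Fin (M + 1))) (y z : Digits M) :
    piQ M q (cat w y) - piQ M q (cat w z) = (piQ M q y - piQ M q z) / q ^ w.length := by
  have h0 : 0 < q := by linarith
  induction w with
  | nil => simp
  | cons a w ih =>
    rw [cat_cons, cat_cons, piQ_cons hq, piQ_cons hq, ← sub_div, add_sub_add_left_eq_sub, ih,
      List.length_cons, pow_succ, div_div]

lemma piQ_cat_lt {q : ℝ} (hq : 1 < q) (w : List (Fin (M + 1))) {y z : Digits M} :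
    piQ M q (cat w y) < piQ M q (cat w z) ↔ piQ M q y < piQ M q z := by
  have h0 : 0 < q := by linarith
  rw [← sub_neg, piQ_cat_sub hq, ← sub_neg (b := piQ M q z), div_neg_iff]
  have : 0 < q ^ w.length := by positivity
  constructor
  · rintro (h | h)
    · linarith [h.2]
    · exact h.1
  · intro h; exact Or.inr ⟨h, this⟩

lemma piQ_cat_le {q : ℝ} (hq : 1 < q) (w : List (Fin (M + 1))) {y z : Digits M} :
    piQ M q (cat w y) ≤ piQ M q (cat w z) ↔ piQ M q y ≤ piQ M q z := by
  rw [← not_lt, piQ_cat_lt hq, not_lt]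

lemma piQ_antitone {p q : ℝ} (hp : 1 < p) (hpq : p ≤ q) (d : Digits M) :
    piQ M q d ≤ piQ M p d := by
  have h0 : 0 < p := by linarith
  refine (summable_piQ (by linarith) d).tsum_le_tsum (fun i => ?_) (summable_piQ hp d)
  gcongr

lemma piQ_sub_le {p q : ℝ} (hp : 1 < p) (hpq : p ≤ q) (d : Digits M) :
    piQ M p d - piQ M q d ≤ M / (p - 1) - M / (q - 1) := by
  have := piQ_antitone hp hpq (compl d)
  rw [piQ_compl hp, piQ_compl (by linarith)] at this
  linarith

/-! ### Unique expansions -/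

lemma one_le_max {q : ℝ} (hq : 1 < q) (hqM : q ≤ M + 1) : 1 ≤ (M : ℝ) / (q - 1) := by
  rw [le_div_iff₀ (by linarith)]; linarith

lemma exists_expansion {q : ℝ} (hq : 1 < q) (hqM : q ≤ M + 1) {y : ℝ} (h0 : 0 ≤ y)
    (h1 : y ≤ M / (q - 1)) : ∃ d : Digits M, piQ M q d = y := by
  have hq0 : 0 < q := by linarith
  have hq1 : 0 < q - 1 := by linarith
  have hM := one_le_max hq hqM
  have step : ∀ z : Set.Icc (0 : ℝ) (M / (q - 1)), ∃ a : Fin (M + 1),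
      ∃ z' : Set.Icc (0 : ℝ) (M / (q - 1)), (z : ℝ) = (a + z') / q := by
    rintro ⟨z, hz0, hz1⟩
    have hqz : 0 ≤ q * z := by positivity
    by_cases hf : q * z < M
    · have hle := Nat.floor_le hqz
      have hlt := Nat.lt_floor_add_one (q * z)
      have hfM : ⌊q * z⌋₊ < M + 1 := by
        have : (⌊q * z⌋₊ : ℝ) < M := by linarith
        have : ⌊q * z⌋₊ < M := by exact_mod_cast this
        omega
      refine ⟨⟨⌊q * z⌋₊, hfM⟩, ⟨q * z - ⌊q * z⌋₊, by linarith, by linarith⟩, ?_⟩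
      simp; field_simp
    · push Not at hf
      refine ⟨Fin.last M, ⟨q * z - M, by linarith, ?_⟩, ?_⟩
      · have : q * z ≤ q * (M / (q - 1)) := by gcongr
        have e : q * (M / (q - 1)) - M = M / (q - 1) := by field_simp; ring
        linarith
      · simp; field_simp
  choose a T hT using step
  let orb : ℕ → Set.Icc (0 : ℝ) (M / (q - 1)) := fun n => T^[n] ⟨y, h0, h1⟩
  have horb : ∀ n, orb (n + 1) = T (orb n) := fun n => Function.iterate_succ_apply' _ _ _
  refine ⟨fun n => a (orb n), ?_⟩
  have hsum : ∀ n, ∑ i ∈ Finset.range n, (a (orb i) : ℝ) / q ^ (i + 1) = y - orb n / q ^ n := by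
    intro n
    induction n with
    | zero => simp [orb]
    | succ n ih =>
      rw [Finset.sum_range_succ, ih, horb]
      have := hT (orb n)
      rw [this]; field_simp; ring
  have hs := (summable_piQ hq (fun n => a (orb n))).hasSum.tendsto_sum_nat
  refine tendsto_nhds_unique hs ?_
  simp only [hsum]
  have : Filter.Tendsto (fun n => ((orb n : ℝ)) / q ^ n) Filter.atTop (nhds 0) := by
    have hg : Filter.Tendsto (fun n : ℕ => (M : ℝ) / (q - 1) / q ^ n) Filter.atTop (nhds 0) :=
      Filter.Tendsto.div_atTop tendsto_const_nhds (tendsto_pow_atTop_atTop_of_one_lt hq)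
    refine squeeze_zero (fun n => ?_) (fun n => ?_) hg
    · have := (orb n).2.1; positivity
    · have := (orb n).2.2; gcongr
  simpa using this.const_sub y

/-- The condition for the digit `a` followed by `y` not to be replaceable by another digit. -/
def Cond (M : ℕ) (q : ℝ) (a : Fin (M + 1)) (y : Digits M) : Prop :=
  ((a : ℕ) < M → piQ M q y < 1) ∧ (0 < (a : ℕ) → piQ M q (compl y) < 1)

lemma Cond.rev {q : ℝ} {a : Fin (M + 1)} {y : Digits M} (h : Cond M q a y) :
    Cond M q a.rev (compl y) := by
  refine ⟨fun ha => h.2 ?_, fun ha => ?_⟩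
  · rw [Fin.val_rev] at ha; omega
  · rw [compl_compl]; apply h.1; rw [Fin.val_rev] at ha; omega

lemma Cond.mono {p q : ℝ} (hp : 1 < p) (hpq : p ≤ q) {a : Fin (M + 1)} {y : Digits M}
    (h : Cond M p a y) : Cond M q a y :=
  ⟨fun ha => (piQ_antitone hp hpq _).trans_lt (h.1 ha),
    fun ha => (piQ_antitone hp hpq _).trans_lt (h.2 ha)⟩

lemma Cond.lt {q : ℝ} (hq : 1 < q) {a a' : Fin (M + 1)} {y y' : Digits M} (h : Cond M q a y)
    (haa : a < a') : piQ M q (cons a y) < piQ M q (cons a' y') := by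
  rw [piQ_cons hq, piQ_cons hq]
  have h1 : piQ M q y < 1 := h.1 (by have := a'.2; have : (a : ℕ) < a' := haa; omega)
  have h2 := piQ_nonneg hq y'
  have h3 : (a : ℝ) + 1 ≤ a' := by exact_mod_cast haa
  gcongr ?_ / q
  linarith

lemma Cond.gt {q : ℝ} (hq : 1 < q) {a a' : Fin (M + 1)} {y y' : Digits M} (h : Cond M q a y)
    (haa : a' < a) : piQ M q (cons a' y') < piQ M q (cons a y) := by
  have := h.rev.lt hq (y' := compl y') (Fin.rev_lt_rev.2 haa)
  rw [← compl_cons, ← compl_cons, piQ_compl hq, piQ_compl hq] at this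
  linarith

lemma compl_mem_UqSym {q : ℝ} (hq : 1 < q) {d : Digits M} (h : d ∈ UqSym M q) :
    compl d ∈ UqSym M q := by
  intro e he
  rw [piQ_compl hq] at he
  rw [← h (compl e) (by rw [piQ_compl hq]; linarith), compl_compl]

lemma piQ_sh_lt_one {q : ℝ} (hq : 1 < q) (hqM : q ≤ M + 1) {d : Digits M} (h : d ∈ UqSym M q)
    {n : ℕ} (hn : (d n : ℕ) < M) : piQ M q (sh (n + 1) d) < 1 := by
  have hq0 : 0 < q := by linarith
  by_contra! hlt
  obtain ⟨e, he⟩ := exists_expansion hq hqM (y := piQ M q (sh (n + 1) d) - 1) (by linarith)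
    (by linarith [piQ_le hq (sh (n + 1) d)])
  have h1 := h (cat (pre n d) (cons ⟨d n + 1, by omega⟩ e)) ?_
  · have h2 : cat (pre n d) (cons ⟨d n + 1, by omega⟩ e) = cat (pre n d) (sh n d) := by
      rw [h1, cat_pre]
    have h3 := congrFun (cat_injective _ h2) 0
    simp only [cons_zero, sh_apply, zero_add] at h3
    have := congrArg Fin.val h3
    simp at this
  · conv_rhs => rw [← cat_pre n d]
    rw [← sub_eq_zero, piQ_cat_sub hq, piQ_cons hq, piQ_eq_head hq (sh n d), he, sh_sh]
    simp [sh_apply, add_comm]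

lemma mem_UqSym_iff {q : ℝ} (hq : 1 < q) (hqM : q ≤ M + 1) {d : Digits M} :
    d ∈ UqSym M q ↔ ∀ n, Cond M q (d n) (sh (n + 1) d) := by
  constructor
  · refine fun h n => ⟨piQ_sh_lt_one hq hqM h, fun hn => ?_⟩
    rw [← sh_compl]
    refine piQ_sh_lt_one hq hqM (compl_mem_UqSym hq h) ?_
    have := (d n).2
    simp only [compl, Fin.val_rev]; omega
  · intro h e he
    by_contra hne
    have hex : ∃ n, e n ≠ d n := by
      by_contra! hc; exact hne (funext hc)
    have hmin : pre (Nat.find hex) e = pre (Nat.find hex) d :=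
      pre_eq_iff.2 fun i hi => by simpa using Nat.find_min hex hi
    have hspec := Nat.find_spec hex
    set n := Nat.find hex
    have hd : d = cat (pre n d) (cons (d n) (sh (n + 1) d)) := by
      conv_lhs => rw [← cat_pre n d]
      rw [← cons_sh_one (sh n d), sh_sh, sh_apply, add_comm 1 n, zero_add]
    have he' : e = cat (pre n d) (cons (e n) (sh (n + 1) e)) := by
      conv_lhs => rw [← cat_pre n e]
      rw [← cons_sh_one (sh n e), sh_sh, sh_apply, add_comm 1 n, zero_add, hmin]
    rcases lt_or_gt_of_ne hspec with hlt | hlt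
    · have := (piQ_cat_lt hq (pre n d)).2 ((h n).gt hq (y' := sh (n + 1) e) hlt)
      rw [← hd, ← he'] at this
      linarith
    · have := (piQ_cat_lt hq (pre n d)).2 ((h n).lt hq (y' := sh (n + 1) e) hlt)
      rw [← hd, ← he'] at this
      linarith

lemma UqSym_mono {p q : ℝ} (hp : 1 < p) (hpq : p ≤ q) (hqM : q ≤ M + 1) :
    UqSym M p ⊆ UqSym M q := fun _ h =>
  (mem_UqSym_iff (by linarith) hqM).2 fun n =>
    ((mem_UqSym_iff hp (by linarith)).1 h n).mono hp hpq

lemma cons_mem_UqSym {q : ℝ} (hq : 1 < q) (hqM : q ≤ M + 1) {a : Fin (M + 1)} {y : Digits M} :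
    cons a y ∈ UqSym M q ↔ Cond M q a y ∧ y ∈ UqSym M q := by
  simp only [mem_UqSym_iff hq hqM]
  constructor
  · exact fun h => ⟨h 0, fun n => h (n + 1)⟩
  · rintro ⟨h0, h⟩ n
    cases n with
    | zero => exact h0
    | succ n => exact h n

lemma sh_mem_UqSym {q : ℝ} (hq : 1 < q) (hqM : q ≤ M + 1) {d : Digits M}
    (h : d ∈ UqSym M q) (n : ℕ) : sh n d ∈ UqSym M q := by
  rw [mem_UqSym_iff hq hqM] at h ⊢
  intro k
  have := h (k + n)
  rwa [sh_sh, show k + 1 + n = k + n + 1 by ring]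

lemma cat_mem_UqSym {q : ℝ} (hq : 1 < q) (hqM : q ≤ M + 1) {w : List (Fin (M + 1))}
    {y : Digits M} : cat w y ∈ UqSym M q ↔
      (∀ r a s, w = r ++ a :: s → Cond M q a (cat s y)) ∧ y ∈ UqSym M q := by
  induction w with
  | nil => simp
  | cons b w ih =>
    rw [cat_cons, cons_mem_UqSym hq hqM, ih, ← and_assoc]
    refine and_congr_left fun _ => ⟨?_, fun h => ⟨h [] b w rfl, fun r a s hw => ?_⟩⟩
    · rintro ⟨h0, h⟩ r a s hw
      cases r with
      | nil => simp at hw; rw [← hw.1, ← hw.2]; exact h0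
      | cons c r => simp at hw; exact h r a s hw.2
    · exact h (b :: r) a s (by simp [hw])

/-- Unique expansions are separated by the words they start with. -/
lemma separated {q : ℝ} (hq : 1 < q) (hqM : q ≤ M + 1) {u w : List (Fin (M + 1))}
    (hl : u.length = w.length) (hne : u ≠ w) :
    (∀ y z, cat u y ∈ UqSym M q → cat w z ∈ UqSym M q →
      piQ M q (cat u y) < piQ M q (cat w z)) ∨
    (∀ y z, cat u y ∈ UqSym M q → cat w z ∈ UqSym M q →
      piQ M q (cat w z) < piQ M q (cat u y)) := by
  have hq0 : 0 < q := by linarith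
  induction u generalizing w with
  | nil => cases w <;> simp_all
  | cons a u ih =>
    cases w with
    | nil => simp at hl
    | cons b w =>
      simp only [cat_cons, cons_mem_UqSym hq hqM]
      rcases lt_trichotomy a b with h | rfl | h
      · exact Or.inl fun y z hy _ => hy.1.lt hq h
      · have := ih (w := w) (by simpa using hl) (by simpa using hne)
        simp only [piQ_cons hq, div_lt_div_iff_of_pos_right hq0, add_lt_add_iff_left]
        exact this.imp (fun H y z hy hz => H y z hy.2 hz.2) (fun H y z hy hz => H y z hy.2 hz.2)
      · exact Or.inr fun y z hy _ => hy.1.gt hq h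

lemma not_endsInZero_of_mem {q : ℝ} (hq : 1 < q) (hqM : q ≤ M + 1) {d : Digits M}
    (h : d ∈ UqSym M q) (hne : d ≠ fun _ => 0) : ¬ EndsInZero d := by
  intro hz
  apply hne
  obtain ⟨N, hN⟩ := hz
  induction N with
  | zero => exact funext fun n => hN n (Nat.zero_le _)
  | succ N ih =>
    refine ih fun n hn => ?_
    rcases hn.lt_or_eq with h' | rfl
    · exact hN n h'
    · by_contra h0
      have := ((mem_UqSym_iff hq hqM).1 h N).2 (Nat.pos_of_ne_zero fun h => h0 (Fin.ext h))
      have hs : sh (N + 1) d = fun _ => 0 := funext fun i => hN _ (by omega)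
      rw [hs, piQ_compl hq] at this
      simp only [piQ, Fin.val_zero, Nat.cast_zero, zero_div, tsum_zero] at this
      linarith [one_le_max hq hqM]

lemma mem_UxSym_of {x q : ℝ} (hx : 0 < x) (hq : 1 < q) (hqM : q ≤ M + 1) {d : Digits M}
    (hd : d ∈ UqSym M q) (hpi : piQ M q d = x) : d ∈ UxSym M x := by
  have hne : d ≠ fun _ => 0 := by
    rintro rfl
    simp [piQ] at hpi
    linarith
  have hqg : ∀ e, IsQuasiGreedy M q x e ↔ e = d := by
    intro e
    constructor
    · exact fun h => hd e (h.1.trans hpi.symm)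
    · rintro rfl
      exact ⟨hpi, not_endsInZero_of_mem hq hqM hd hne,
        fun e he _ => Or.inl (hd e (he.trans hpi.symm))⟩
  refine ⟨q, ⟨⟨hq, hqM⟩, d, hpi, fun e he => hd e (he.trans hpi.symm)⟩, ?_⟩
  have hex : ∃ e, IsQuasiGreedy M q x e := ⟨d, (hqg d).2 rfl⟩
  rw [Phi, dif_pos hex]
  exact (hqg _).1 hex.choose_spec

lemma UxSym_subset {x : ℝ} (hx : 0 < x) : UxSym M x ⊆ UqSym M (qx M x) := by
  rintro _ ⟨q, ⟨⟨hq, hqM⟩, d, hd, huniq⟩, rfl⟩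
  have hdU : d ∈ UqSym M q := fun e he => huniq e (he.trans hd)
  have hne : d ≠ fun _ => 0 := by
    rintro rfl
    simp [piQ] at hd
    linarith
  have hex : ∃ e, IsQuasiGreedy M q x e :=
    ⟨d, hd, not_endsInZero_of_mem hq hqM hdU hne, fun e he _ => Or.inl (huniq e he)⟩
  have hphi : Phi M x q = d := by
    rw [Phi, dif_pos hex]
    exact huniq _ hex.choose_spec.1
  rw [hphi]
  have hle := piQ_le hq d
  rw [hd] at hle
  refine UqSym_mono hq (le_min hqM ?_) (min_le_left _ _) hdU
  rw [le_div_iff₀ (by linarith)] at hle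
  rw [← sub_le_iff_le_add', le_div_iff₀ hx]
  linarith

/-! ### Null sets for cylinder covers -/

/-- `A` can be covered by cylinders `cyl w` with arbitrarily small sum of `θ ^ |w|`. -/
def Null (θ : ℝ≥0∞) (A : Set (Digits M)) : Prop :=
  ∀ ε : ℝ≥0∞, 0 < ε → ∃ W : Set (List (Fin (M + 1))),
    A ⊆ ⋃ w ∈ W, cyl w ∧ ∑' w : W, θ ^ w.1.length ≤ ε

lemma Null.mono {θ : ℝ≥0∞} {A B : Set (Digits M)} (h : Null θ B) (hAB : A ⊆ B) : Null θ A :=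
  fun ε hε => let ⟨W, h1, h2⟩ := h ε hε; ⟨W, hAB.trans h1, h2⟩

lemma Null.mono_weight {θ θ' : ℝ≥0∞} {A : Set (Digits M)} (h : Null θ A) (hle : θ' ≤ θ) :
    Null θ' A := fun ε hε => let ⟨W, h1, h2⟩ := h ε hε
  ⟨W, h1, (ENNReal.tsum_le_tsum fun w => by gcongr).trans h2⟩

lemma null_of_indexed {θ : ℝ≥0∞} {A : Set (Digits M)}
    (h : ∀ ε : ℝ≥0∞, 0 < ε → ∃ (ι : Type) (f : ι → List (Fin (M + 1))),
      A ⊆ ⋃ i, cyl (f i) ∧ ∑' i, θ ^ (f i).length ≤ ε) : Null θ A := by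
  intro ε hε
  obtain ⟨ι, f, h1, h2⟩ := h ε hε
  refine ⟨Set.range f, by simpa using h1, le_trans ?_ h2⟩
  exact ENNReal.tsum_le_tsum_comp_of_surjective (f := Set.rangeFactorization f)
    Set.rangeFactorization_surjective (fun w : Set.range f => θ ^ w.1.length)

lemma Null.iUnion {θ : ℝ≥0∞} {ι : Type} [Countable ι] {A : ι → Set (Digits M)}
    (h : ∀ i, Null θ (A i)) : Null θ (⋃ i, A i) := by
  refine null_of_indexed fun ε hε => ?_
  obtain ⟨ε', hpos, hsum⟩ := ENNReal.exists_pos_sum_of_countable' hε.ne' ι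
  choose W h1 h2 using fun i => h i (ε' i) (hpos i)
  refine ⟨Σ i, W i, fun p => p.2.1, ?_, ?_⟩
  · refine Set.iUnion_subset fun i d hd => ?_
    obtain ⟨w, hw, hdw⟩ := Set.mem_iUnion₂.1 (h1 i hd)
    exact Set.mem_iUnion.2 ⟨⟨i, w, hw⟩, hdw⟩
  · rw [ENNReal.tsum_sigma (fun i (w : W i) => θ ^ w.1.length)]
    exact (ENNReal.tsum_le_tsum h2).trans hsum.le

lemma Null.union {θ : ℝ≥0∞} {A B : Set (Digits M)} (hA : Null θ A) (hB : Null θ B) :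
    Null θ (A ∪ B) := by
  rw [Set.union_eq_iUnion]
  exact Null.iUnion fun b => by cases b <;> assumption

lemma exists_pow_le {θ ε : ℝ≥0∞} (hθ : θ < 1) (hε : 0 < ε) : ∃ n : ℕ, θ ^ n ≤ ε := by
  have := ENNReal.tendsto_pow_atTop_nhds_zero_of_lt_one hθ
  exact ((this.eventually (gt_mem_nhds hε)).exists).imp fun _ h => h.le

lemma null_singleton {θ : ℝ≥0∞} (hθ : θ < 1) (d : Digits M) : Null θ {d} := by
  refine null_of_indexed fun ε hε => ?_
  obtain ⟨n, hn⟩ := exists_pow_le hθ hε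
  refine ⟨Unit, fun _ => pre n d, ?_, by simpa using hn⟩
  simp [mem_cyl_iff]

lemma Null.sh_one {θ : ℝ≥0∞} (hθ : θ < 1) {A : Set (Digits M)} (h : Null θ A) :
    Null θ {d | sh 1 d ∈ A} := by
  have : {d : Digits M | sh 1 d ∈ A} ⊆ ⋃ a, {d | d 0 = a ∧ sh 1 d ∈ A} := by
    intro d hd; simpa using hd
  refine Null.mono (Null.iUnion fun a => ?_) this
  refine null_of_indexed fun ε hε => ?_
  obtain ⟨W, h1, h2⟩ := h ε hε
  refine ⟨W, fun w => a :: w.1, ?_, le_trans (ENNReal.tsum_le_tsum fun w => ?_) h2⟩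
  · rintro d ⟨hd0, hd⟩
    obtain ⟨w, hw, y, hy⟩ := Set.mem_iUnion₂.1 (h1 hd)
    exact Set.mem_iUnion.2 ⟨⟨w, hw⟩, y, by simp [hy, ← hd0]⟩
  · rw [List.length_cons, pow_succ]
    exact mul_le_of_le_one_right' hθ.le

lemma Null.sh {θ : ℝ≥0∞} (hθ : θ < 1) {A : Set (Digits M)} (h : Null θ A) (n : ℕ) :
    Null θ {d | sh n d ∈ A} := by
  induction n with
  | zero => simpa using h
  | succ n ih =>
    refine (ih.sh_one hθ).mono fun d hd => ?_
    simpa [sh_sh] using hd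

lemma Null.cons {θ : ℝ≥0∞} (h0 : θ ≠ 0) (hθ : θ < 1) {B : Set (Digits M)} (h : Null θ B)
    (a : Fin (M + 1)) : Null θ {y | cons a y ∈ B} := by
  refine null_of_indexed fun ε hε => ?_
  obtain ⟨W, h1, h2⟩ := h (min (θ * ε) (θ / 2)) (by
    have : 0 < θ := pos_iff_ne_zero.2 h0
    refine lt_min (ENNReal.mul_pos h0 hε.ne') (ENNReal.half_pos h0))
  refine ⟨W, fun w => w.1.tail, ?_, ?_⟩
  · intro y hy
    obtain ⟨w, hw, z, hz⟩ := Set.mem_iUnion₂.1 (h1 hy)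
    refine Set.mem_iUnion.2 ⟨⟨w, hw⟩, ?_⟩
    cases w with
    | nil => exact ⟨y, rfl⟩
    | cons b w => exact ⟨z, (cons_injective hz).2⟩
  · have hW : ∀ w : W, θ ^ w.1.tail.length ≤ θ⁻¹ * θ ^ w.1.length := by
      rintro ⟨w, hw⟩
      cases w with
      | nil => simpa using hθ.le
      | cons b w =>
        rw [List.length_cons, pow_succ', ← mul_assoc, ENNReal.inv_mul_cancel h0 hθ.ne_top]
        simp
    refine (ENNReal.tsum_le_tsum hW).trans ?_
    rw [ENNReal.tsum_mul_left]
    calc θ⁻¹ * ∑' w : W, θ ^ w.1.length ≤ θ⁻¹ * (θ * ε) := by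
          gcongr; exact h2.trans (min_le_left _ _)
      _ = ε := by rw [← mul_assoc, ENNReal.inv_mul_cancel h0 hθ.ne_top, one_mul]

lemma Null.cat {θ : ℝ≥0∞} (h0 : θ ≠ 0) (hθ : θ < 1) {B : Set (Digits M)} (h : Null θ B)
    (u : List (Fin (M + 1))) : Null θ {y | cat u y ∈ B} := by
  induction u generalizing B with
  | nil => simpa using h
  | cons a u ih => exact ih (h.cons h0 hθ a)

/-! ### Comparison with the Hausdorff dimension -/

/-- The ratio `1/(M+1)` of the metric `ρ`. -/
noncomputable def ratio (M : ℕ) : ℝ≥0∞ := ((M : ℝ≥0∞) + 1)⁻¹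

lemma ratio_ne_zero : ratio M ≠ 0 := by
  unfold ratio; simp

lemma ratio_ne_top : ratio M ≠ ⊤ := by
  unfold ratio; simp

lemma ratio_le_one : ratio M ≤ 1 := by
  unfold ratio; simp

lemma ratio_lt_one (hM : 0 < M) : ratio M < 1 := by
  unfold ratio
  rw [ENNReal.inv_lt_one]
  exact_mod_cast (by omega : 1 < M + 1)

lemma weight_lt_one (hM : 0 < M) {t : ℝ} (ht : 0 < t) : ratio M ^ t < 1 :=
  ENNReal.rpow_lt_one (ratio_lt_one hM) ht

lemma weight_ne_zero {t : ℝ} : ratio M ^ t ≠ 0 := by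
  intro h
  rcases ENNReal.rpow_eq_zero_iff.1 h with h | h
  · exact ratio_ne_zero h.1
  · exact ratio_ne_top h.1

lemma weight_pow {t : ℝ} (n : ℕ) : (ratio M ^ t) ^ n = (ratio M ^ n) ^ t := by
  rw [← ENNReal.rpow_natCast, ← ENNReal.rpow_natCast, ← ENNReal.rpow_mul, ← ENNReal.rpow_mul,
    mul_comm]

lemma ofReal_zpow (n : ℕ) :
    ENNReal.ofReal (((M : ℝ) + 1) ^ (-((n : ℤ) + 1))) = ratio M ^ (n + 1) := by
  have : ((M : ℝ) + 1) ^ (-((n : ℤ) + 1)) = (((M : ℝ) + 1)⁻¹) ^ (n + 1) := by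
    rw [zpow_neg, inv_pow]; norm_cast
  rw [this, ENNReal.ofReal_pow (by positivity), ENNReal.ofReal_inv_of_pos (by positivity),
    ratio, ENNReal.ofReal_add (by positivity) (by positivity)]
  simp

lemma gdiam_cyl_le (w : List (Fin (M + 1))) : gdiam (rho M) (cyl w) ≤ ratio M ^ w.length := by
  refine iSup₂_le fun c hc => iSup₂_le fun d hd => ?_
  rw [rho]
  split_ifs with h
  · simp
  · rw [ofReal_zpow]
    refine pow_le_pow_right_of_le_one' ratio_le_one ?_
    rw [mem_cyl_iff] at hc hd
    have := pre_eq_iff.1 (hc.trans hd.symm)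
    have hne : {i | c i ≠ d i}.Nonempty := by
      by_contra! he
      exact h (funext fun i => by_contra fun hi => by
        have : i ∈ ({i | c i ≠ d i} : Set ℕ) := hi
        simp [he] at this)
    have hm := Nat.sInf_mem hne
    by_contra! hlt
    exact hm (this _ (by omega))

lemma dim_le_of_null {t : ℝ≥0} (ht : 0 < t) {A : Set (Digits M)}
    (h : Null (ratio M ^ (t : ℝ)) A) : gdimH (rho M) A ≤ t := by
  refine iSup₂_le fun s hs => ?_
  by_contra! hlt
  have hst : t < s := by exact_mod_cast hlt
  have ht' : (0 : ℝ) < t := ht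
  have hs' : (0 : ℝ) < s := by exact_mod_cast ht.trans hst
  suffices gHMeasure (rho M) s A ≤ 1 by rw [hs] at this; simp at this
  refine iSup₂_le fun δ hδ => ?_
  obtain ⟨W, h1, h2⟩ := h (min 1 (ENNReal.ofReal δ ^ (t : ℝ))) (by
    refine lt_min one_pos (ENNReal.rpow_pos (by simpa using hδ) ENNReal.ofReal_ne_top))
  obtain ⟨e⟩ : Nonempty (ℕ ≃ List (Fin (M + 1))) := nonempty_equiv_of_countable
  have hgd0 : gdiam (rho M) (∅ : Set (Digits M)) = 0 := by simp [gdiam]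
  have hle : ∀ w ∈ W, ratio M ^ w.length ≤ ENNReal.ofReal δ := by
    intro w hw
    have := (ENNReal.le_tsum (⟨w, hw⟩ : W)).trans (h2.trans (min_le_right _ _))
    rw [weight_pow] at this
    exact (ENNReal.rpow_le_rpow_iff ht').1 this
  refine (iInf_le _ (fun n => if e n ∈ W then cyl (e n) else ∅)).trans ?_
  refine (iInf₂_le ?_ ?_).trans ?_
  · intro d hd
    obtain ⟨w, hw, hdw⟩ := Set.mem_iUnion₂.1 (h1 hd)
    refine Set.mem_iUnion.2 ⟨e.symm w, by simpa [hw] using hdw⟩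
  · intro n
    dsimp only
    split_ifs with hn
    · exact (gdiam_cyl_le _).trans (hle _ hn)
    · simp [hgd0]
  · have hterm : ∀ n, gdiam (rho M) (if e n ∈ W then cyl (e n) else ∅) ^ (s : ℝ) ≤
        W.indicator (fun w => (ratio M ^ (t : ℝ)) ^ w.length) (e n) := by
      intro n
      by_cases hn : e n ∈ W
      · rw [if_pos hn, Set.indicator_of_mem hn, weight_pow]
        calc gdiam (rho M) (cyl (e n)) ^ (s : ℝ) ≤ (ratio M ^ (e n).length) ^ (s : ℝ) :=
              ENNReal.rpow_le_rpow (gdiam_cyl_le _) hs'.le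
          _ ≤ _ := ENNReal.rpow_le_rpow_of_exponent_ge (pow_le_one' ratio_le_one _)
            (by exact_mod_cast hst.le)
      · rw [if_neg hn, hgd0, ENNReal.zero_rpow_of_pos hs']; exact zero_le
    refine (ENNReal.tsum_le_tsum hterm).trans ?_
    rw [e.tsum_eq (W.indicator (fun w => (ratio M ^ (t : ℝ)) ^ w.length)), ← tsum_subtype]
    exact h2.trans (min_le_left _ _)

lemma exists_cyl_cover {θ : ℝ≥0∞} {s : ℝ} (hs : 0 < s) (hθ : θ = ratio M ^ s) (hM : 0 < M)
    (C : Set (Digits M)) {ε : ℝ≥0∞} (hε : 0 < ε) : ∃ w : List (Fin (M + 1)), C ⊆ cyl w ∧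
      θ ^ w.length ≤ ε + θ⁻¹ * gdiam (rho M) C ^ s := by
  have hθ1 : θ < 1 := hθ ▸ weight_lt_one hM hs
  have h0 : θ ≠ 0 := hθ ▸ weight_ne_zero
  obtain ⟨n, hn⟩ := exists_pow_le hθ1 hε
  rcases C.eq_empty_or_nonempty with rfl | ⟨c, hc⟩
  · exact ⟨List.replicate n 0, Set.empty_subset _, by simpa using hn.trans le_self_add⟩
  by_cases hC : ∃ m, ∃ d ∈ C, d m ≠ c m
  · have hmin : ∀ i < Nat.find hC, ∀ d ∈ C, d i = c i := fun i hi d hd => by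
      by_contra hne; exact Nat.find_min hC hi ⟨d, hd, hne⟩
    obtain ⟨d, hd, hne⟩ := Nat.find_spec hC
    set m := Nat.find hC
    refine ⟨pre m c, fun e he => ?_, ?_⟩
    · rw [mem_cyl_iff, length_pre, pre_eq_iff]
      exact fun i hi => hmin i hi e he
    · refine le_trans ?_ le_add_self
      have hdiam : ratio M ^ (m + 1) ≤ gdiam (rho M) C := by
        have h1 : ENNReal.ofReal (rho M d c) ≤ gdiam (rho M) C :=
          (le_iSup₂ (f := fun y _ => ENNReal.ofReal (rho M d y)) c hc).trans
            (le_iSup₂ (f := fun x _ => ⨆ y ∈ C, ENNReal.ofReal (rho M x y)) d hd)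
        rw [rho, if_neg (fun h => hne (congrFun h m)), ofReal_zpow] at h1
        refine le_trans (pow_le_pow_right_of_le_one' ratio_le_one ?_) h1
        exact Nat.succ_le_succ (Nat.sInf_le hne)
      rw [length_pre]
      calc θ ^ m = θ⁻¹ * θ ^ (m + 1) := by
            rw [pow_succ', ← mul_assoc, ENNReal.inv_mul_cancel h0 hθ1.ne_top, one_mul]
        _ ≤ _ := by
            gcongr
            rw [hθ, weight_pow]
            exact ENNReal.rpow_le_rpow hdiam hs.le
  · push Not at hC
    refine ⟨pre n c, fun e he => ?_, by simpa using hn.trans le_self_add⟩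
    rw [mem_cyl_iff, length_pre, pre_eq_iff]
    exact fun i _ => hC i e he

lemma null_of_dim_lt (hM : 0 < M) {t : ℝ≥0} {A : Set (Digits M)} (h : gdimH (rho M) A < t) :
    Null (ratio M ^ (t : ℝ)) A := by
  obtain ⟨r, hr1, hr2⟩ := ENNReal.lt_iff_exists_nnreal_btwn.1 h
  have hrt : r < t := by exact_mod_cast hr2
  have ht : (0 : ℝ) < t := by exact_mod_cast (zero_le : (0 : ℝ≥0) ≤ r).trans_lt hrt
  have hfin : gHMeasure (rho M) r A ≠ ⊤ := fun htop =>
    absurd (le_iSup₂ (f := fun (s : ℝ≥0) (_ : gHMeasure (rho M) s A = ⊤) => (s : ℝ≥0∞)) r htop)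
      (not_le.2 hr1)
  set H := gHMeasure (rho M) r A with hH
  set θ := ratio M ^ (t : ℝ) with hθ
  have hθ0 : θ ≠ 0 := weight_ne_zero
  have hθ1 : θ < 1 := weight_lt_one hM ht
  refine null_of_indexed fun ε hε => ?_
  have hd : (0 : ℝ) < t - r := by
    have : (r : ℝ) < t := by exact_mod_cast hrt
    linarith
  obtain ⟨η, hη0, hη⟩ : ∃ η : ℝ≥0∞, 0 < η ∧ θ⁻¹ * (η * (H + 1)) ≤ ε / 2 := by
    have hK0 : θ⁻¹ * (H + 1) ≠ 0 := by simp [hθ1.ne_top]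
    have hK : θ⁻¹ * (H + 1) ≠ ⊤ :=
      ENNReal.mul_ne_top (ENNReal.inv_ne_top.2 hθ0) (by simp [hfin])
    refine ⟨(ε / 2) / (θ⁻¹ * (H + 1)), ENNReal.div_pos (ENNReal.half_pos hε.ne').ne' hK, ?_⟩
    rw [mul_left_comm]
    exact (ENNReal.div_mul_cancel hK0 hK).le
  obtain ⟨δ, hδ0, hδ⟩ : ∃ δ : ℝ, 0 < δ ∧ ENNReal.ofReal δ ^ ((t : ℝ) - r) ≤ η := by
    have hmin0 : 0 < min η 1 := lt_min hη0 one_pos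
    have hmint : min η 1 ≠ ⊤ := ne_top_of_le_ne_top ENNReal.one_ne_top (min_le_right _ _)
    have hx0 : 0 < (min η 1) ^ ((t : ℝ) - r)⁻¹ := ENNReal.rpow_pos hmin0 hmint
    have hxt : (min η 1) ^ ((t : ℝ) - r)⁻¹ ≠ ⊤ :=
      ENNReal.rpow_ne_top_of_nonneg (inv_nonneg.2 hd.le) hmint
    refine ⟨((min η 1) ^ ((t : ℝ) - r)⁻¹).toReal, ENNReal.toReal_pos hx0.ne' hxt, ?_⟩
    rw [ENNReal.ofReal_toReal hxt, ← ENNReal.rpow_mul, inv_mul_cancel₀ hd.ne', ENNReal.rpow_one]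
    exact min_le_left _ _
  have hlt : (⨅ (C : ℕ → Set (Digits M)) (_ : A ⊆ ⋃ n, C n)
      (_ : ∀ n, gdiam (rho M) (C n) ≤ ENNReal.ofReal δ),
      ∑' n, gdiam (rho M) (C n) ^ (r : ℝ)) < H + 1 :=
    (le_iSup₂ (f := fun (δ : ℝ) (_ : 0 < δ) => ⨅ (C : ℕ → Set (Digits M)) (_ : A ⊆ ⋃ n, C n)
      (_ : ∀ n, gdiam (rho M) (C n) ≤ ENNReal.ofReal δ),
      ∑' n, gdiam (rho M) (C n) ^ (r : ℝ)) δ hδ0).trans_lt (ENNReal.lt_add_right hfin one_ne_zero)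
  simp only [iInf_lt_iff] at hlt
  obtain ⟨C, hAC, hCδ, hsum⟩ := hlt
  obtain ⟨ε', hpos, hε'⟩ := ENNReal.exists_pos_sum_of_countable'
    (ENNReal.half_pos hε.ne').ne' ℕ
  choose w hw1 hw2 using fun n => exists_cyl_cover ht hθ hM (C n) (hpos n)
  refine ⟨ℕ, w, hAC.trans (Set.iUnion_mono hw1), ?_⟩
  calc ∑' n, θ ^ (w n).length
      ≤ ∑' n, (ε' n + θ⁻¹ * (η * gdiam (rho M) (C n) ^ (r : ℝ))) := by
        refine ENNReal.tsum_le_tsum fun n => (hw2 n).trans ?_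
        gcongr
        have : (t : ℝ) = (t - r) + r := by ring
        conv_lhs => rw [this]
        rw [ENNReal.rpow_add_of_nonneg (t - r : ℝ) (r : ℝ) hd.le r.2]
        gcongr
        exact (ENNReal.rpow_le_rpow (hCδ n) hd.le).trans hδ
    _ = ∑' n, ε' n + θ⁻¹ * (η * ∑' n, gdiam (rho M) (C n) ^ (r : ℝ)) := by
        rw [ENNReal.tsum_add, ENNReal.tsum_mul_left, ENNReal.tsum_mul_left]
    _ ≤ ε / 2 + ε / 2 := by
        gcongr
        exact le_trans (by gcongr) hη
    _ = ε := ENNReal.add_halves ε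

lemma dim_mono_of_null (hM : 0 < M) {A B : Set (Digits M)}
    (h : ∀ t t' : ℝ≥0, 0 < t → t < t' → Null (ratio M ^ (t : ℝ)) B → Null (ratio M ^ (t' : ℝ)) A) :
    gdimH (rho M) A ≤ gdimH (rho M) B := by
  by_contra! hlt
  obtain ⟨t', ht1, ht2⟩ := ENNReal.lt_iff_exists_nnreal_btwn.1 hlt
  obtain ⟨t, hs1, hs2⟩ := ENNReal.lt_iff_exists_nnreal_btwn.1 ht1
  have htt : t < t' := by exact_mod_cast hs2
  have ht0 : 0 < t := by exact_mod_cast zero_le.trans_lt hs1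
  have := dim_le_of_null (ht0.trans htt) (h t t' ht0 htt (null_of_dim_lt hM hs1))
  exact absurd this (not_le.2 ht2)

lemma dim_mono (hM : 0 < M) {A B : Set (Digits M)} (h : A ⊆ B) :
    gdimH (rho M) A ≤ gdimH (rho M) B :=
  dim_mono_of_null hM fun _ _ _ htt hB => (hB.mono h).mono_weight
    (ENNReal.rpow_le_rpow_of_exponent_ge ratio_le_one (by exact_mod_cast htt.le))

lemma pre_cat_pre (n : ℕ) (d y : Digits M) : pre n (cat (pre n d) y) = pre n d := by
  simpa using pre_cat (pre n d) y

/-! ### Words with room on both sides -/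

/-- After the word `u`, every admissible continuation by the block `B` lies strictly between two
admissible continuations of `u`. -/
def Nice (M : ℕ) (b : ℝ) (u B : List (Fin (M + 1))) : Prop :=
  ∃ y₁ y₂ : Digits M, cat u y₁ ∈ UqSym M b ∧ cat u y₂ ∈ UqSym M b ∧
    ∀ z, cat B z ∈ UqSym M b → piQ M b y₁ < piQ M b (cat B z) ∧ piQ M b (cat B z) < piQ M b y₂

lemma piQ_compl_le {q : ℝ} (hq : 1 < q) {y z : Digits M} (h : piQ M q y ≤ piQ M q z) :
    piQ M q (compl z) ≤ piQ M q (compl y) := by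
  rw [piQ_compl hq, piQ_compl hq]; linarith

lemma Nice.cat_mem {b : ℝ} (hb : 1 < b) (hbM : b ≤ M + 1) {u B : List (Fin (M + 1))}
    (h : Nice M b u B) {z : Digits M} (hz : cat B z ∈ UqSym M b) :
    cat u (cat B z) ∈ UqSym M b := by
  obtain ⟨y₁, y₂, h1, h2, h⟩ := h
  rw [cat_mem_UqSym hb hbM] at h1 h2 ⊢
  refine ⟨fun r a s hu => ⟨fun ha => ?_, fun ha => ?_⟩, hz⟩
  · exact ((piQ_cat_le hb s).2 (h z hz).2.le).trans_lt ((h2.1 r a s hu).1 ha)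
  · exact (piQ_compl_le hb ((piQ_cat_le hb s).2 (h z hz).1.le)).trans_lt ((h1.1 r a s hu).2 ha)

lemma Nice.suffix {b : ℝ} (hb : 1 < b) (hbM : b ≤ M + 1) {u v B : List (Fin (M + 1))}
    (h : Nice M b (u ++ v) B) : Nice M b v B := by
  obtain ⟨y₁, y₂, h1, h2, h⟩ := h
  refine ⟨y₁, y₂, ?_, ?_, h⟩
  · rw [cat_append] at h1
    simpa [sh_cat] using sh_mem_UqSym hb hbM h1 u.length
  · rw [cat_append] at h2
    simpa [sh_cat] using sh_mem_UqSym hb hbM h2 u.length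

lemma Nice.comp {b : ℝ} (hb : 1 < b) (hbM : b ≤ M + 1) {u v A B : List (Fin (M + 1))}
    (hu : Nice M b u A) (hv : Nice M b v B) (hA : ∀ y, cat v y ∈ cyl A) :
    Nice M b (u ++ v) B := by
  obtain ⟨y₁, y₂, h1, h2, h⟩ := hv
  refine ⟨y₁, y₂, ?_, ?_, h⟩
  · rw [cat_append]
    obtain ⟨z, hz⟩ := hA y₁
    rw [← hz] at h1 ⊢
    exact hu.cat_mem hb hbM h1
  · rw [cat_append]
    obtain ⟨z, hz⟩ := hA y₂
    rw [← hz] at h2 ⊢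
    exact hu.cat_mem hb hbM h2

lemma nice_of_between {b : ℝ} (hb : 1 < b) (hbM : b ≤ M + 1) {u B₁ B₂ B₃ : List (Fin (M + 1))}
    (hl₁ : B₁.length = B₂.length) (hl₃ : B₂.length = B₃.length) (h12 : B₁ ≠ B₂) (h23 : B₂ ≠ B₃)
    {z₁ z₂ z₃ : Digits M} (h₁ : cat u (cat B₁ z₁) ∈ UqSym M b)
    (h₂ : cat u (cat B₂ z₂) ∈ UqSym M b) (h₃ : cat u (cat B₃ z₃) ∈ UqSym M b)
    (hlt₁ : piQ M b (cat B₁ z₁) ≤ piQ M b (cat B₂ z₂))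
    (hlt₃ : piQ M b (cat B₂ z₂) ≤ piQ M b (cat B₃ z₃)) : Nice M b u B₂ := by
  have m₁ := ((cat_mem_UqSym hb hbM).1 h₁).2
  have m₂ := ((cat_mem_UqSym hb hbM).1 h₂).2
  have m₃ := ((cat_mem_UqSym hb hbM).1 h₃).2
  refine ⟨_, _, h₁, h₃, fun z hz => ⟨?_, ?_⟩⟩
  · rcases separated hb hbM hl₁ h12 with h | h
    · exact h _ _ m₁ hz
    · exact absurd (h _ _ m₁ m₂) (not_lt.2 hlt₁)
  · rcases separated hb hbM hl₃ h23 with h | h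
    · exact h _ _ hz m₃
    · exact absurd (h _ _ m₂ m₃) (not_lt.2 hlt₃)

/-- At most two blocks of a given length can follow `u` without being nice. -/
lemma exists_pair_of_not_nice {b : ℝ} (hb : 1 < b) (hbM : b ≤ M + 1) (k : ℕ)
    (u : List (Fin (M + 1))) : ∃ c : Bool → List (Fin (M + 1)), (∀ i, (c i).length = k) ∧
      ∀ B : List (Fin (M + 1)), B.length = k → (∃ z, cat u (cat B z) ∈ UqSym M b) →
        ¬ Nice M b u B → ∃ i, B = c i := by
  by_contra! hc
  have aux : ∀ B₁ B₂ : List (Fin (M + 1)), B₁.length = k → B₂.length = k →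
      ∃ B : List (Fin (M + 1)), B.length = k ∧ (∃ z, cat u (cat B z) ∈ UqSym M b) ∧
        ¬ Nice M b u B ∧ B ≠ B₁ ∧ B ≠ B₂ := by
    intro B₁ B₂ hB₁ hB₂
    obtain ⟨B, h1, h2, h3, h4⟩ := hc (fun i => cond i B₁ B₂) (by rintro (_ | _) <;> simpa)
    exact ⟨B, h1, h2, h3, h4 true, h4 false⟩
  have hr : (List.replicate k (0 : Fin (M + 1))).length = k := List.length_replicate
  obtain ⟨B₁, l₁, ⟨z₁, m₁⟩, n₁, -, -⟩ := aux _ _ hr hr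
  obtain ⟨B₂, l₂, ⟨z₂, m₂⟩, n₂, h21, -⟩ := aux _ _ l₁ hr
  obtain ⟨B₃, l₃, ⟨z₃, m₃⟩, n₃, h31, h32⟩ := aux _ _ l₁ l₂
  have key : ∀ {A B C : List (Fin (M + 1))} {x y z : Digits M}, A.length = k → B.length = k →
      C.length = k → A ≠ B → B ≠ C → cat u (cat A x) ∈ UqSym M b → cat u (cat B y) ∈ UqSym M b →
      cat u (cat C z) ∈ UqSym M b → ¬ Nice M b u B →
      ¬ (piQ M b (cat A x) ≤ piQ M b (cat B y) ∧ piQ M b (cat B y) ≤ piQ M b (cat C z)) := by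
    rintro A B C x y z hA hB hC hAB hBC mA mB mC hn ⟨h1, h2⟩
    exact hn (nice_of_between hb hbM (hA.trans hB.symm) (hB.trans hC.symm) hAB hBC mA mB mC h1 h2)
  have k1 := key l₁ l₂ l₃ h21.symm h32.symm m₁ m₂ m₃ n₂
  have k2 := key l₃ l₂ l₁ h32 h21 m₃ m₂ m₁ n₂
  have k3 := key l₂ l₁ l₃ h21 h31.symm m₂ m₁ m₃ n₁
  have k4 := key l₃ l₁ l₂ h31 h21.symm m₃ m₁ m₂ n₁
  have k5 := key l₁ l₃ l₂ h31.symm h32 m₁ m₃ m₂ n₃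
  have k6 := key l₂ l₃ l₁ h32.symm h31 m₂ m₃ m₁ n₃
  grind

/-- Sequences none of whose block prefixes is nice. -/
def Rigid (M : ℕ) (b : ℝ) (k : ℕ) : Set (Digits M) :=
  {d | d ∈ UqSym M b ∧ ∀ j, 1 ≤ j → ¬ Nice M b (pre (j * k) d) (pre k (sh (j * k) d))}

lemma null_rigid {b : ℝ} (hb : 1 < b) (hbM : b ≤ M + 1) {k : ℕ} {θ : ℝ≥0∞} (hθ : θ ≤ 1)
    (h2 : 2 * θ ^ k < 1) : Null θ (Rigid M b k) := by
  choose c hlen hc using exists_pair_of_not_nice (M := M) hb hbM k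
  let word : List (Fin (M + 1)) → List Bool → List (Fin (M + 1)) := fun A v =>
    v.foldr (fun i w => w ++ c w i) A
  have hword : ∀ A : List (Fin (M + 1)), A.length = k →
      ∀ v, (word A v).length = (v.length + 1) * k := by
    intro A hA v
    induction v with
    | nil => simpa [word] using hA
    | cons i v ih =>
      simp only [word, List.foldr_cons, List.length_append, hlen, List.length_cons] at ih ⊢
      rw [ih]; ring
  have hcov : ∀ d ∈ Rigid M b k, ∀ j, ∃ v : List Bool, v.length = j ∧
      pre ((j + 1) * k) d = word (pre k d) v := by
    rintro d ⟨hd, hn⟩ j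
    induction j with
    | zero => exact ⟨[], rfl, by simp [word]⟩
    | succ j ih =>
      obtain ⟨v, hv, hpre⟩ := ih
      obtain ⟨i, hi⟩ := hc (pre ((j + 1) * k) d) (pre k (sh ((j + 1) * k) d)) (length_pre _ _)
        ⟨sh k (sh ((j + 1) * k) d), by rwa [cat_pre, cat_pre]⟩ (hn _ (by omega))
      refine ⟨i :: v, by simp [hv], ?_⟩
      rw [show (j + 1 + 1) * k = (j + 1) * k + k by ring, pre_add, hi, hpre]
      rfl
  have hsub : Rigid M b k ⊆ ⋃ A : {A : List (Fin (M + 1)) // A.length = k},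
      {d | d ∈ Rigid M b k ∧ pre k d = A.1} := fun d hd =>
    Set.mem_iUnion.2 ⟨⟨pre k d, length_pre _ _⟩, hd, rfl⟩
  refine (Null.iUnion fun A => null_of_indexed fun ε hε => ?_).mono hsub
  obtain ⟨n, hn⟩ := exists_pow_le h2 hε
  refine ⟨List.Vector Bool n, fun v => word A.1 v.1, ?_, ?_⟩
  · rintro d ⟨hd, hA⟩
    obtain ⟨v, hv, hpre⟩ := hcov d hd n
    refine Set.mem_iUnion.2 ⟨⟨v, hv⟩, ?_⟩
    rw [mem_cyl_iff, hword _ A.2, hv, hpre, hA]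
  · have : ∀ v : List.Vector Bool n, θ ^ (word A.1 v.1).length = θ ^ ((n + 1) * k) := fun v => by
      rw [hword _ A.2, v.2]
    rw [tsum_congr this, tsum_fintype, Finset.sum_const, Finset.card_univ, card_vector,
      Fintype.card_bool, nsmul_eq_mul]
    refine le_trans ?_ hn
    rw [mul_pow, ← pow_mul, mul_comm k n]
    push_cast
    gcongr 2 ^ n * ?_
    exact pow_le_pow_right_of_le_one' hθ (by nlinarith)

/-- Sequences returning infinitely often to the block `A` in a nice way. -/
def Recur (M : ℕ) (b : ℝ) (A : List (Fin (M + 1))) : Set (Digits M) :=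
  {d | d ∈ UqSym M b ∧ d ∈ cyl A ∧ ∀ N, ∃ n ≥ N, sh n d ∈ cyl A ∧ Nice M b (pre n d) A}

lemma exists_rigid_or_recur {b : ℝ} (hb : 1 < b) (hbM : b ≤ M + 1) {k : ℕ} (hk : 1 ≤ k)
    {d : Digits M} (hd : d ∈ UqSym M b) : (∃ m, sh m d ∈ Rigid M b k) ∨
      ∃ m, ∃ A : List (Fin (M + 1)), A.length = k ∧ sh m d ∈ Recur M b A := by
  by_cases hR : ∃ m, sh m d ∈ Rigid M b k
  · exact Or.inl hR
  right
  have step : ∀ m, ∃ l, k ≤ l ∧ Nice M b (pre l (sh m d)) (pre k (sh (m + l) d)) := by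
    intro m
    by_contra! hc
    refine hR ⟨m, sh_mem_UqSym hb hbM hd m, fun j hj => ?_⟩
    have := hc (j * k) (by nlinarith)
    rwa [sh_sh, add_comm]
  choose l hl hnice using step
  let m : ℕ → ℕ := fun i => (fun m => m + l m)^[i] 0
  have hm : ∀ i, m (i + 1) = m i + l (m i) := fun i => Function.iterate_succ_apply' _ _ _
  have hmono : StrictMono m := strictMono_nat_of_lt_succ fun i => by
    rw [hm]; have := hl (m i); omega
  have hchain : ∀ n i, Nice M b (pre (m (i + n + 1) - m i) (sh (m i) d))
      (pre k (sh (m (i + n + 1)) d)) := by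
    intro n
    induction n with
    | zero =>
      intro i
      have := hnice (m i)
      rwa [← hm, show l (m i) = m (i + 1) - m i by rw [hm]; omega] at this
    | succ n ih =>
      intro i
      have h1 := hnice (m i)
      have h2 := ih (i + 1)
      rw [show i + 1 + n + 1 = i + (n + 1) + 1 by ring] at h2
      have hle : m (i + 1) ≤ m (i + (n + 1) + 1) := hmono.monotone (by omega)
      have hle2 : m (i + 1 + 1) ≤ m (i + (n + 1) + 1) := hmono.monotone (by omega)
      have hlen : k ≤ m (i + (n + 1) + 1) - m (i + 1) := by
        have := hl (m (i + 1)); have := hm (i + 1)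
        omega
      have hsplit : m (i + (n + 1) + 1) - m i = l (m i) + (m (i + (n + 1) + 1) - m (i + 1)) := by
        have := hm i
        omega
      rw [hsplit, pre_add, sh_sh, add_comm (l (m i)) (m i), ← hm]
      rw [← hm] at h1
      refine h1.comp hb hbM h2 fun y => ?_
      rw [mem_cyl_iff, length_pre]
      refine pre_eq_of_le hlen ?_
      exact pre_cat_pre _ _ _
  obtain ⟨c, hcinf⟩ := Finite.exists_infinite_fiber
    (fun i => (fun j : Fin k => d (j + m i) : Fin k → Fin (M + 1)))
  have hinf : Set.Infinite
      ((fun i => (fun j : Fin k => d (j + m i) : Fin k → Fin (M + 1))) ⁻¹' {c}) :=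
    Set.infinite_coe_iff.1 hcinf
  obtain ⟨i₀, hi₀⟩ := hinf.nonempty
  have hpre : ∀ i, (fun j : Fin k => d (j + m i)) = c →
      pre k (sh (m i) d) = pre k (sh (m i₀) d) := by
    intro i hi
    refine pre_eq_iff.2 fun j hj => ?_
    exact congrFun (hi.trans (Eq.symm hi₀)) ⟨j, hj⟩
  refine ⟨m i₀, pre k (sh (m i₀) d), length_pre _ _, sh_mem_UqSym hb hbM hd _, ?_, fun N => ?_⟩
  · rw [mem_cyl_iff, length_pre]
  · obtain ⟨i, hi, hgt⟩ := hinf.exists_gt (i₀ + N)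
    have hge : N + m i₀ ≤ m i := by
      have : ∀ n, n + m i₀ ≤ m (i₀ + n) := by
        intro n
        induction n with
        | zero => simp
        | succ n ih =>
          have := hmono (show i₀ + n < i₀ + (n + 1) by omega)
          omega
      exact (this N).trans (hmono.monotone hgt.le)
    refine ⟨m i - m i₀, by omega, ?_, ?_⟩
    · rw [sh_sh, show m i - m i₀ + m i₀ = m i by omega, mem_cyl_iff, length_pre]
      exact hpre i hi
    · have := hchain (i - i₀ - 1) i₀
      rw [show i₀ + (i - i₀ - 1) + 1 = i by omega, hpre i hi] at this
      exact this

/-! ### First return words -/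

/-- The first return words to the block `A`. -/
def FirstReturn (M : ℕ) (b : ℝ) (A : List (Fin (M + 1))) : Set (List (Fin (M + 1))) :=
  {w | A.length ≤ w.length ∧ Nice M b w A ∧ ∀ d ∈ cyl w, sh w.length d ∈ cyl A → d ∈ cyl A ∧
    ∀ n, A.length ≤ n → n < w.length → sh n d ∈ cyl A → ¬ Nice M b (pre n d) A}

lemma FirstReturn.eq {b : ℝ} {A v w : List (Fin (M + 1))} (hv : v ∈ FirstReturn M b A)
    (hw : w ∈ FirstReturn M b A) {d : Digits M} (h1 : d ∈ cyl v) (h2 : sh v.length d ∈ cyl A)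
    (h3 : d ∈ cyl w) (h4 : sh w.length d ∈ cyl A) : v = w := by
  have e1 := mem_cyl_iff.1 h1
  have e2 := mem_cyl_iff.1 h3
  rcases lt_trichotomy v.length w.length with h | h | h
  · exact absurd hv.2.1 (e1 ▸ (hw.2.2 d h3 h4).2 _ hv.1 h h2)
  · rw [← e1, ← e2, h]
  · exact absurd hw.2.1 (e2 ▸ (hv.2.2 d h1 h2).2 _ hw.1 h h4)

lemma cyl_congr {w : List (Fin (M + 1))} {d e : Digits M} {N n : ℕ} (hN : n + w.length ≤ N)
    (h : pre N d = pre N e) (hd : sh n d ∈ cyl w) : sh n e ∈ cyl w := by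
  rw [mem_cyl_iff] at hd ⊢
  rw [← hd, length_pre, pre_eq_iff]
  intro i hi
  rw [pre_eq_iff] at h
  exact (h (i + n) (by omega)).symm

lemma exists_firstReturn {b : ℝ} (hb : 1 < b) (hbM : b ≤ M + 1) {A : List (Fin (M + 1))}
    {d : Digits M} (hd : d ∈ Recur M b A) :
    ∃ w ∈ FirstReturn M b A, ∃ e ∈ Recur M b A, cat w e = d := by
  obtain ⟨hS, hA, hrec⟩ := hd
  have hex : ∃ n, A.length ≤ n ∧ sh n d ∈ cyl A ∧ Nice M b (pre n d) A := by
    obtain ⟨n, h1, h2⟩ := hrec A.length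
    exact ⟨n, h1, h2⟩
  obtain ⟨h1, h2, h3⟩ := Nat.find_spec hex
  have hmin : ∀ i < Nat.find hex, A.length ≤ i → sh i d ∈ cyl A → ¬ Nice M b (pre i d) A :=
    fun i hi hi1 hi2 hi3 => Nat.find_min hex hi ⟨hi1, hi2, hi3⟩
  set n := Nat.find hex
  refine ⟨pre n d, ⟨by simpa, h3, ?_⟩, sh n d, ⟨sh_mem_UqSym hb hbM hS n, h2, fun N => ?_⟩,
    cat_pre n d⟩
  · intro e he heA
    rw [length_pre] at heA ⊢
    rw [mem_cyl_iff, length_pre] at he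
    have hagree : pre (n + A.length) e = pre (n + A.length) d := by
      rw [pre_add, pre_add, he]
      rw [mem_cyl_iff] at heA h2
      rw [heA, h2]
    refine ⟨?_, fun i hi hin hie => ?_⟩
    · exact cyl_congr (n := 0) (by omega) hagree.symm hA
    · rw [pre_eq_of_le hin.le he]
      exact hmin i hin hi (cyl_congr (by omega) hagree hie)
  · obtain ⟨m, hm1, hm2, hm3⟩ := hrec (N + n)
    refine ⟨m - n, by omega, ?_, ?_⟩
    · rwa [sh_sh, show m - n + n = m by omega]
    · rw [show m = n + (m - n) by omega, pre_add] at hm3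
      exact hm3.suffix hb hbM

lemma null_recur_of_sum_le {b : ℝ} (hb : 1 < b) (hbM : b ≤ M + 1) {A : List (Fin (M + 1))}
    (hA : 1 ≤ A.length) {θ θ' ρ : ℝ≥0∞} (hρ : ρ < 1) (hθ : θ' ≤ ρ * θ)
    (hsum : ∑' w : FirstReturn M b A, θ ^ w.1.length ≤ 1) : Null θ' (Recur M b A) := by
  have hcov : ∀ n : ℕ, ∃ (ι : Type) (f : ι → List (Fin (M + 1))),
      Recur M b A ⊆ ⋃ i, {d | ∃ e ∈ Recur M b A, cat (f i) e = d} ∧ (∀ i, n ≤ (f i).length) ∧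
      ∑' i, θ ^ (f i).length ≤ 1 := by
    intro n
    induction n with
    | zero => exact ⟨Unit, fun _ => [], fun d hd => by simpa using hd, by simp, by simp⟩
    | succ n ih =>
      obtain ⟨ι, f, h1, h2, h3⟩ := ih
      refine ⟨ι × FirstReturn M b A, fun p => f p.1 ++ p.2.1, ?_, ?_, ?_⟩
      · intro d hd
        obtain ⟨i, e, he, rfl⟩ := Set.mem_iUnion.1 (h1 hd)
        obtain ⟨w, hw, e', he', rfl⟩ := exists_firstReturn hb hbM he
        exact Set.mem_iUnion.2 ⟨(i, ⟨w, hw⟩), e', he', by rw [cat_append]⟩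
      · rintro ⟨i, w, hw⟩
        have := h2 i
        have := hw.1
        simp only [List.length_append]
        omega
      · simp only [List.length_append, pow_add]
        rw [ENNReal.tsum_prod (f := fun i (w : FirstReturn M b A) =>
          θ ^ (f i).length * θ ^ w.1.length)]
        simp only [ENNReal.tsum_mul_left, ENNReal.tsum_mul_right]
        exact mul_le_one' h3 hsum
  refine null_of_indexed fun ε hε => ?_
  obtain ⟨n, hn⟩ := exists_pow_le hρ hε
  obtain ⟨ι, f, h1, h2, h3⟩ := hcov n
  refine ⟨ι, f, h1.trans (Set.iUnion_mono ?_), ?_⟩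
  · rintro i _ ⟨e, -, rfl⟩
    exact cat_mem_cyl _ _
  · calc ∑' i, θ' ^ (f i).length ≤ ∑' i, ρ ^ n * θ ^ (f i).length := by
          refine ENNReal.tsum_le_tsum fun i => (pow_le_pow_left' hθ _).trans ?_
          rw [mul_pow]
          exact mul_le_mul' (pow_le_pow_right_of_le_one' hρ.le (h2 i)) le_rfl
      _ = ρ ^ n * ∑' i, θ ^ (f i).length := ENNReal.tsum_mul_left
      _ ≤ ρ ^ n * 1 := by gcongr
      _ ≤ ε := by rwa [mul_one]

/-! ### Infinite concatenations -/

section Concat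

variable {V : Type} (W : V → List (Fin (M + 1)))

/-- Concatenation of the first `n` words of the sequence `f`. -/
def flat : ℕ → (ℕ → V) → List (Fin (M + 1))
  | 0, _ => []
  | n + 1, f => W (f 0) ++ flat n (fun i => f (i + 1))

/-- The infinite concatenation of the words of the sequence `f`. -/
def infcat (f : ℕ → V) : Digits M := fun i => cat (flat W (i + 1) f) (fun _ => 0) i

lemma cat_congr (w : List (Fin (M + 1))) {y z : Digits M} {i : ℕ}
    (h : ∀ j, j + w.length = i → y j = z j) : cat w y i = cat w z i := by
  induction w generalizing i with
  | nil => exact h i rfl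
  | cons a w ih =>
    cases i with
    | zero => rfl
    | succ i => exact ih fun j hj => h j (by simp; omega)

lemma flat_stable (hW : ∀ v, 1 ≤ (W v).length) {n m : ℕ} (hnm : n ≤ m) {f : ℕ → V} {i : ℕ}
    (hi : i < n) (y z : Digits M) : cat (flat W n f) y i = cat (flat W m f) z i := by
  induction n generalizing m f i with
  | zero => omega
  | succ n ih =>
    obtain ⟨m, rfl⟩ : ∃ m', m = m' + 1 := ⟨m - 1, by omega⟩
    simp only [flat, cat_append]
    refine cat_congr _ fun j hj => ih (by omega) ?_
    have := hW (f 0)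
    omega

lemma infcat_eq (hW : ∀ v, 1 ≤ (W v).length) (f : ℕ → V) :
    infcat W f = cat (W (f 0)) (infcat W fun i => f (i + 1)) := by
  funext i
  simp only [infcat]
  rw [flat, cat_append]
  refine cat_congr _ fun j hj => ?_
  refine (flat_stable W hW ?_ (Nat.lt_succ_self j) _ _).symm
  have := hW (f 0)
  omega

lemma infcat_eq_flat (hW : ∀ v, 1 ≤ (W v).length) (n : ℕ) (f : ℕ → V) :
    infcat W f = cat (flat W n f) (infcat W fun i => f (i + n)) := by
  induction n generalizing f with
  | zero => rfl
  | succ n ih =>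
    rw [infcat_eq W hW, flat, cat_append, ih]
    simp only [add_assoc]

lemma length_flat_ge (hW : ∀ v, 1 ≤ (W v).length) (n : ℕ) (f : ℕ → V) :
    n ≤ (flat W n f).length := by
  induction n generalizing f with
  | zero => simp
  | succ n ih =>
    have := ih fun i => f (i + 1)
    have := hW (f 0)
    simp only [flat, List.length_append]
    omega

lemma length_flat_succ_le {L : ℕ} (hL : ∀ v, (W v).length ≤ L) (n : ℕ) (f : ℕ → V) :
    (flat W (n + 1) f).length ≤ (flat W n f).length + L := by
  induction n generalizing f with
  | zero => simpa [flat] using hL (f 0)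
  | succ n ih =>
    have h1 := ih fun i => f (i + 1)
    have h2 : (flat W (n + 1 + 1) f).length =
        (W (f 0)).length + (flat W (n + 1) fun i => f (i + 1)).length := List.length_append
    have h3 : (flat W (n + 1) f).length =
        (W (f 0)).length + (flat W n fun i => f (i + 1)).length := List.length_append
    omega

lemma pow_length_flat (θ : ℝ≥0∞) (n : ℕ) (f : ℕ → V) :
    θ ^ (flat W n f).length = ∏ i ∈ Finset.range n, θ ^ (W (f i)).length := by
  induction n generalizing f with
  | zero => simp [flat]
  | succ n ih => rw [flat, List.length_append, pow_add, ih, Finset.prod_range_succ']; ring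

variable {W} {b : ℝ} {A : List (Fin (M + 1))}

lemma infcat_mem_cyl (hA : 1 ≤ A.length) (hW : ∀ v, W v ∈ FirstReturn M b A)
    (hne : ∃ e : Digits M, e ∈ cyl A) (f : ℕ → V) : infcat W f ∈ cyl A := by
  have hW1 : ∀ v, 1 ≤ (W v).length := fun v => hA.trans (hW v).1
  obtain ⟨e, he⟩ := hne
  have hmem : cat (W (f 0)) e ∈ cyl A :=
    ((hW (f 0)).2.2 _ (cat_mem_cyl _ _) (by rwa [sh_cat])).1
  rw [infcat_eq W hW1]
  refine cyl_congr (n := 0) (N := (W (f 0)).length) (by simpa using (hW (f 0)).1) ?_ hmem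
  rw [pre_cat, pre_cat]

lemma agree_of_pre (hinj : Function.Injective W) (hA : 1 ≤ A.length)
    (hW : ∀ v, W v ∈ FirstReturn M b A) (n : ℕ) (f g : ℕ → V)
    (h : n = 0 ∨ pre ((flat W n f).length + A.length) (infcat W f) =
      pre ((flat W n f).length + A.length) (infcat W g)) : ∀ i < n, g i = f i := by
  have hW1 : ∀ v, 1 ≤ (W v).length := fun v => hA.trans (hW v).1
  have hcyl : ∀ f : ℕ → V, infcat W f ∈ cyl A :=
    infcat_mem_cyl hA hW ⟨cat A fun _ => 0, cat_mem_cyl _ _⟩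
  have hsh : ∀ f : ℕ → V, sh (W (f 0)).length (infcat W f) = infcat W fun i => f (i + 1) :=
    fun f => by conv_lhs => rw [infcat_eq W hW1, sh_cat]
  have hmem : ∀ f : ℕ → V, infcat W f ∈ cyl (W (f 0)) := fun f => by
    rw [infcat_eq W hW1]; exact cat_mem_cyl _ _
  induction n generalizing f g with
  | zero => intro i hi; omega
  | succ n ih =>
    have h := h.resolve_left (by omega)
    simp only [flat, List.length_append] at h
    have h0 : g 0 = f 0 := by
      refine hinj (FirstReturn.eq (hW _) (hW _) (hmem g) ?_ (d := infcat W g) ?_ ?_)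
      · rw [hsh]; exact hcyl _
      · exact cyl_congr (n := 0) (by omega) h (hmem f)
      · refine cyl_congr (by omega) h ?_
        rw [hsh]; exact hcyl _
    have hrest := ih (fun i => f (i + 1)) (fun i => g (i + 1)) (Or.inr ?_)
    · intro i hi
      cases i with
      | zero => exact h0
      | succ i => exact hrest i (by omega)
    · rw [← hsh, ← hsh g, h0, pre_eq_iff]
      intro i hi
      exact pre_eq_iff.1 h (i + (W (f 0)).length) (by omega)

open MeasureTheory in
lemma not_null_infcat [Fintype V] (hinj : Function.Injective W) (hA : 1 ≤ A.length)
    (hW : ∀ v, W v ∈ FirstReturn M b A) {θ : ℝ≥0∞} (hθ0 : θ ≠ 0) (hθ : θ < 1)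
    (hsum : 1 ≤ ∑ v, θ ^ (W v).length) : ¬ Null θ (Set.range (infcat W)) := by
  intro hnull
  obtain ⟨L, hL⟩ : ∃ L, ∀ v, (W v).length ≤ L :=
    ⟨∑ v, (W v).length, fun v => Finset.single_le_sum (f := fun v => (W v).length)
      (fun _ _ => Nat.zero_le _) (Finset.mem_univ v)⟩
  have hW1 : ∀ v, 1 ≤ (W v).length := fun v => hA.trans (hW v).1
  set c : V → ℝ≥0∞ := fun v => θ ^ (W v).length with hc
  have hc0 : ∑' v, c v ≠ 0 := by
    rw [tsum_fintype]; exact (one_pos.trans_le hsum).ne'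
  have hct : ∑' v, c v ≠ ⊤ := by
    rw [tsum_fintype]
    exact (ENNReal.sum_lt_top.2 fun v _ => ENNReal.pow_lt_top hθ.lt_top).ne
  let mV : MeasurableSpace V := ⊤
  let ν : Measure V := (PMF.normalize c hc0 hct).toMeasure
  have hνp : IsProbabilityMeasure ν := PMF.toMeasure.isProbabilityMeasure _
  have hν : ∀ v, ν {v} ≤ c v := fun v => by
    rw [PMF.toMeasure_apply_singleton _ _ MeasurableSpace.measurableSet_top, PMF.normalize_apply]
    refine mul_le_of_le_one_right' (ENNReal.inv_le_one.2 ?_)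
    rwa [tsum_fintype]
  let μ : Measure (ℕ → V) := Measure.infinitePi fun _ => ν
  have hμ : ∀ (n : ℕ) (f : ℕ → V), μ {g | ∀ i < n, g i = f i} ≤ θ ^ (flat W n f).length := by
    intro n f
    have hset : {g : ℕ → V | ∀ i < n, g i = f i} = Set.pi (Finset.range n) fun i => {f i} := by
      ext g; simp
    rw [hset, pow_length_flat]
    refine (Measure.infinitePi_pi (fun _ => ν)
      (fun _ _ => MeasurableSpace.measurableSet_top)).trans_le ?_
    exact Finset.prod_le_prod' fun i _ => hν _
  set K := θ ^ (L + A.length) with hK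
  have hK0 : K ≠ 0 := pow_ne_zero _ hθ0
  have hKt : K ≠ ⊤ := (ENNReal.pow_lt_top hθ.lt_top).ne
  have hcyl : ∀ w : List (Fin (M + 1)), μ {f | infcat W f ∈ cyl w} ≤ K⁻¹ * θ ^ w.length := by
    intro w
    rcases Set.eq_empty_or_nonempty {f | infcat W f ∈ cyl w} with he | ⟨f, hf⟩
    · rw [he]; simp
    have hex : ∃ n, w.length < (flat W (n + 1) f).length + A.length :=
      ⟨w.length, by have := length_flat_ge W hW1 (w.length + 1) f; omega⟩
    have hspec := Nat.find_spec hex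
    have hmin := fun i => Nat.find_min hex (m := i)
    set n := Nat.find hex
    have hsub : {g | infcat W g ∈ cyl w} ⊆ {g | ∀ i < n, g i = f i} := by
      intro g hg
      refine agree_of_pre hinj hA hW n f g ?_
      rcases Nat.eq_zero_or_pos n with h0 | hpos
      · exact Or.inl h0
      right
      have := hmin (n - 1) (by omega)
      rw [show n - 1 + 1 = n by omega, not_lt] at this
      refine pre_eq_of_le this ?_
      rw [mem_cyl_iff.1 hf, mem_cyl_iff.1 hg]
    refine (measure_mono hsub).trans ((hμ n f).trans ?_)
    rw [mul_comm, ← div_eq_mul_inv, ENNReal.le_div_iff_mul_le (Or.inl hK0) (Or.inl hKt), hK,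
      ← pow_add]
    refine pow_le_pow_right_of_le_one' hθ.le ?_
    have := length_flat_succ_le W hL n f
    omega
  obtain ⟨C, hC1, hC2⟩ := hnull (K / 2) (ENNReal.half_pos hK0)
  have hone : (1 : ℝ≥0∞) ≤ K⁻¹ * (K / 2) := by
    calc (1 : ℝ≥0∞) = μ Set.univ := measure_univ.symm
      _ ≤ μ (⋃ w : C, {f | infcat W f ∈ cyl w.1}) := by
          refine measure_mono fun f _ => ?_
          obtain ⟨w, hw, h⟩ := Set.mem_iUnion₂.1 (hC1 ⟨f, rfl⟩)
          exact Set.mem_iUnion.2 ⟨⟨w, hw⟩, h⟩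
      _ ≤ ∑' w : C, μ {f | infcat W f ∈ cyl w.1} := measure_iUnion_le _
      _ ≤ ∑' w : C, K⁻¹ * θ ^ w.1.length := ENNReal.tsum_le_tsum fun w => hcyl _
      _ = K⁻¹ * ∑' w : C, θ ^ w.1.length := ENNReal.tsum_mul_left
      _ ≤ K⁻¹ * (K / 2) := by gcongr
  rw [div_eq_mul_inv, ← mul_assoc, ENNReal.inv_mul_cancel hK0 hKt, one_mul] at hone
  simp at hone

end Concat

/-! ### Approximation from smaller bases -/

lemma mem_UqSym_of_invariant {q : ℝ} (hq : 1 < q) (hqM : q ≤ M + 1) {Y : Set (Digits M)}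
    (hY : ∀ d ∈ Y, ∃ w ≠ [], ∃ y ∈ Y, cat w y = d ∧
      ∀ r a s, w = r ++ a :: s → Cond M q a (cat s y)) : Y ⊆ UqSym M q := by
  intro d hd
  rw [mem_UqSym_iff hq hqM]
  intro n
  induction n using Nat.strong_induction_on generalizing d with
  | _ n ih =>
    obtain ⟨w, hw, y, hy, rfl, hcond⟩ := hY d hd
    rcases lt_or_ge n w.length with h | h
    · obtain ⟨a, ha⟩ : ∃ a, a = w[n] := ⟨_, rfl⟩
      have hsplit : w = w.take n ++ a :: w.drop (n + 1) := by
        rw [ha, List.getElem_cons_drop, List.take_append_drop]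
      have hlen : (w.take n).length = n := by simp; omega
      have hsh : sh n (cat w y) = cons a (cat (w.drop (n + 1)) y) := by
        have := sh_cat (w.take n) (cons a (cat (w.drop (n + 1)) y))
        rwa [hlen, ← cat_cons, ← cat_append, ← hsplit] at this
      have h0 : cat w y n = a := by
        have := congrFun hsh 0
        simpa [sh_apply] using this
      have h1 : sh (n + 1) (cat w y) = cat (w.drop (n + 1)) y := by
        rw [show sh (n + 1) (cat w y) = sh 1 (sh n (cat w y)) by rw [sh_sh, add_comm], hsh,
          sh_one_cons]
      rw [h0, h1]
      exact hcond _ _ _ hsplit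
    · have hpos : 0 < w.length := List.length_pos_iff.2 hw
      have := ih (n - w.length) (by omega) hy
      rw [← sh_cat w y, sh_sh, sh_apply] at this
      rwa [show n - w.length + w.length = n by omega,
        show n - w.length + 1 + w.length = n + 1 by omega] at this

lemma tendsto_gap {b : ℝ} (hb : 1 < b) :
    Filter.Tendsto (fun p : ℝ => (M : ℝ) / (p - 1) - M / (b - 1)) (nhds b) (nhds 0) := by
  have : ContinuousAt (fun p : ℝ => (M : ℝ) / (p - 1) - M / (b - 1)) b := by
    refine ContinuousAt.sub (ContinuousAt.div continuousAt_const (by fun_prop) ?_)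
      continuousAt_const
    linarith
  simpa [ContinuousAt] using this

lemma eventually_cond {b : ℝ} (hb : 1 < b) (hbM : b ≤ M + 1) {y₁ y₂ : Digits M}
    (w : List (Fin (M + 1))) (h₁ : cat w y₁ ∈ UqSym M b) (h₂ : cat w y₂ ∈ UqSym M b) :
    ∀ᶠ p in nhdsWithin b (Set.Iio b), ∀ r a s, w = r ++ a :: s → ∀ y, piQ M b y₁ ≤ piQ M b y →
      piQ M b y ≤ piQ M b y₂ → Cond M p a (cat s y) := by
  induction w with
  | nil => simp
  | cons c w ih =>
    rw [cat_cons, cons_mem_UqSym hb hbM] at h₁ h₂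
    have hlt : ∀ x : ℝ, x < 1 → ∀ᶠ p in nhdsWithin b (Set.Iio b),
        x + ((M : ℝ) / (p - 1) - M / (b - 1)) < 1 := by
      intro x hx
      have := ((tendsto_gap (M := M) hb).const_add x).mono_left
        (nhdsWithin_le_nhds (s := Set.Iio b))
      rw [add_zero] at this
      exact this.eventually (gt_mem_nhds hx)
    have e1 : ∀ᶠ p in nhdsWithin b (Set.Iio b), (c : ℕ) < M →
        piQ M b (cat w y₂) + ((M : ℝ) / (p - 1) - M / (b - 1)) < 1 := by
      by_cases hc : (c : ℕ) < M
      · simpa [hc] using hlt _ (h₂.1.1 hc)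
      · simp [hc]
    have e2 : ∀ᶠ p in nhdsWithin b (Set.Iio b), 0 < (c : ℕ) →
        piQ M b (compl (cat w y₁)) + ((M : ℝ) / (p - 1) - M / (b - 1)) < 1 := by
      by_cases hc : 0 < (c : ℕ)
      · simpa [hc] using hlt _ (h₁.1.2 hc)
      · simp [hc]
    have e3 : ∀ᶠ p in nhdsWithin b (Set.Iio b), 1 < p :=
      nhdsWithin_le_nhds (lt_mem_nhds hb)
    filter_upwards [ih h₁.2 h₂.2, e1, e2, e3, self_mem_nhdsWithin] with p hp h1 h2 h3 h4
    intro r a s hw y hy1 hy2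
    cases r with
    | nil =>
      simp only [List.nil_append, List.cons.injEq] at hw
      obtain ⟨rfl, rfl⟩ := hw
      refine ⟨fun ha => ?_, fun ha => ?_⟩
      · have := piQ_sub_le h3 (le_of_lt h4) (cat w y)
        have := (piQ_cat_le hb w).2 hy2
        linarith [h1 ha]
      · have := piQ_sub_le h3 (le_of_lt h4) (compl (cat w y))
        have := piQ_compl_le hb ((piQ_cat_le hb w).2 hy1)
        linarith [h2 ha]
    | cons x r =>
      simp only [List.cons_append, List.cons.injEq] at hw
      exact hp r a s hw.2 y hy1 hy2

section Concat

variable {V : Type} {W : V → List (Fin (M + 1))} {b : ℝ} {A : List (Fin (M + 1))}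

lemma flat_admissible (hb : 1 < b) (hbM : b ≤ M + 1) (hW : ∀ v, W v ∈ FirstReturn M b A)
    {e : Digits M} (he : e ∈ UqSym M b) (heA : e ∈ cyl A) (n : ℕ) (f : ℕ → V) :
    cat (flat W n f) e ∈ UqSym M b ∧ cat (flat W n f) e ∈ cyl A := by
  induction n generalizing f with
  | zero => exact ⟨he, heA⟩
  | succ n ih =>
    obtain ⟨h1, h2⟩ := ih fun i => f (i + 1)
    rw [flat, cat_append]
    refine ⟨?_, ((hW (f 0)).2.2 _ (cat_mem_cyl _ _) (by rwa [sh_cat])).1⟩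
    obtain ⟨z, hz⟩ := h2
    rw [← hz] at h1 ⊢
    exact (hW (f 0)).2.1.cat_mem hb hbM h1

lemma infcat_between (hb : 1 < b) (hbM : b ≤ M + 1) (hA : 1 ≤ A.length)
    (hW : ∀ v, W v ∈ FirstReturn M b A) {e : Digits M} (he : e ∈ UqSym M b) (heA : e ∈ cyl A)
    {y₁ y₂ : Digits M} (hy : ∀ z, cat A z ∈ UqSym M b →
      piQ M b y₁ < piQ M b (cat A z) ∧ piQ M b (cat A z) < piQ M b y₂) (f : ℕ → V) :
    piQ M b y₁ ≤ piQ M b (infcat W f) ∧ piQ M b (infcat W f) ≤ piQ M b y₂ := by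
  have hW1 : ∀ v, 1 ≤ (W v).length := fun v => hA.trans (hW v).1
  have hb0 : 0 < b := by linarith
  have hlim : Filter.Tendsto (fun n => piQ M b (cat (flat W n f) e)) Filter.atTop
      (nhds (piQ M b (infcat W f))) := by
    rw [tendsto_iff_dist_tendsto_zero]
    have hg : Filter.Tendsto (fun n : ℕ => (M : ℝ) / (b - 1) / b ^ n) Filter.atTop (nhds 0) :=
      Filter.Tendsto.div_atTop tendsto_const_nhds (tendsto_pow_atTop_atTop_of_one_lt hb)
    refine squeeze_zero (fun n => dist_nonneg) (fun n => ?_) hg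
    rw [Real.dist_eq]
    rw [infcat_eq_flat W hW1 n f]
    rw [piQ_cat_sub hb, abs_div, abs_of_pos (pow_pos hb0 _)]
    have hpow : b ^ n ≤ b ^ (flat W n f).length :=
      pow_le_pow_right₀ hb.le (length_flat_ge W hW1 n f)
    have hMb : (0 : ℝ) ≤ M / (b - 1) := (piQ_nonneg hb e).trans (piQ_le hb e)
    refine div_le_div₀ hMb ?_ (by positivity) hpow
    rw [abs_le]
    constructor <;> linarith [piQ_nonneg hb e, piQ_le hb e,
      piQ_nonneg hb (infcat W fun i => f (i + n)), piQ_le hb (infcat W fun i => f (i + n))]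
  have hbd : ∀ n, piQ M b y₁ < piQ M b (cat (flat W n f) e) ∧
      piQ M b (cat (flat W n f) e) < piQ M b y₂ := by
    intro n
    obtain ⟨h1, z, hz⟩ := flat_admissible hb hbM hW he heA n f
    rw [← hz] at h1 ⊢
    exact hy z h1
  exact ⟨ge_of_tendsto' hlim fun n => (hbd n).1.le, le_of_tendsto' hlim fun n => (hbd n).2.le⟩

lemma exists_infcat_subset [Finite V] (hb : 1 < b) (hbM : b ≤ M + 1) (hA : 1 ≤ A.length)
    (hW : ∀ v, W v ∈ FirstReturn M b A) {e : Digits M} (he : e ∈ UqSym M b) (heA : e ∈ cyl A) :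
    ∃ p, 1 < p ∧ p < b ∧ Set.range (infcat W) ⊆ UqSym M p := by
  have hW1 : ∀ v, 1 ≤ (W v).length := fun v => hA.trans (hW v).1
  have hev : ∀ᶠ p in nhdsWithin b (Set.Iio b), ∀ v, ∀ r a s, W v = r ++ a :: s →
      ∀ f, Cond M p a (cat s (infcat W f)) := by
    refine Filter.eventually_all.2 fun v => ?_
    obtain ⟨y₁, y₂, h1, h2, hy⟩ := (hW v).2.1
    filter_upwards [eventually_cond hb hbM (W v) h1 h2] with p hp r a s hs f
    obtain ⟨h3, h4⟩ := infcat_between hb hbM hA hW he heA hy f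
    exact hp r a s hs _ h3 h4
  have e3 : ∀ᶠ p in nhdsWithin b (Set.Iio b), 1 < p := nhdsWithin_le_nhds (lt_mem_nhds hb)
  obtain ⟨p, hp1, hp2, hp3⟩ := (hev.and (e3.and self_mem_nhdsWithin)).exists
  refine ⟨p, hp2, hp3, mem_UqSym_of_invariant hp2 (le_trans (le_of_lt hp3) hbM) ?_⟩
  rintro _ ⟨f, rfl⟩
  refine ⟨W (f 0), ?_, _, ⟨fun i => f (i + 1), rfl⟩, (infcat_eq W hW1 f).symm,
    fun r a s hs => hp1 _ r a s hs _⟩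
  intro h0
  have := hW1 (f 0)
  simp [h0] at this

end Concat

lemma null_recur {b : ℝ} (hb : 1 < b) (hbM : b ≤ M + 1) {A : List (Fin (M + 1))}
    (hA : 1 ≤ A.length) {θ θ' ρ : ℝ≥0∞} (hθ0 : θ ≠ 0) (hθ1 : θ < 1) (hρ : ρ < 1)
    (hθ : θ' ≤ ρ * θ) (hnull : ∀ p, 1 < p → p < b → Null θ (UqSym M p)) :
    Null θ' (Recur M b A) := by
  by_cases hsum : ∑' w : FirstReturn M b A, θ ^ w.1.length ≤ 1
  · exact null_recur_of_sum_le hb hbM hA hρ hθ hsum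
  rcases (Recur M b A).eq_empty_or_nonempty with he | ⟨e, he⟩
  · rw [he]
    exact fun ε _ => ⟨∅, by simp, by simp⟩
  exfalso
  rw [not_le, ENNReal.tsum_eq_iSup_sum, lt_iSup_iff] at hsum
  obtain ⟨F, hF⟩ := hsum
  let W : F → List (Fin (M + 1)) := fun v => v.1.1
  have hW : ∀ v, W v ∈ FirstReturn M b A := fun v => v.1.2
  obtain ⟨p, hp1, hp2, hp⟩ := exists_infcat_subset hb hbM hA hW he.1 he.2.1
  refine not_null_infcat (W := W) (fun v v' h => Subtype.ext (Subtype.ext h)) hA hW hθ0 hθ1 ?_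
    ((hnull p hp1 hp2).mono hp)
  rw [Finset.sum_coe_sort F (fun w : FirstReturn M b A => θ ^ w.1.length)]
  exact hF.le

/-- Smallness of the sets `UqSym M p`, `p < b`, passes to `UqSym M b`. -/
lemma null_UqSym_of_lt {b : ℝ} (hb : 1 < b) (hbM : b ≤ M + 1) {θ θ' ρ : ℝ≥0∞} (hθ0 : θ ≠ 0)
    (hθ1 : θ < 1) (hρ : ρ < 1) (hθ : θ' ≤ ρ * θ)
    (hnull : ∀ p, 1 < p → p < b → Null θ (UqSym M p)) : Null θ' (UqSym M b) := by
  have hθ'1 : θ' < 1 := hθ.trans_lt (mul_lt_one_of_nonneg_of_lt_one_left (zero_le) hρ hθ1.le)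
  obtain ⟨k, hk⟩ := exists_pow_le (θ := θ') (ε := 1 / 4) hθ'1 (by simp)
  have hk' : 2 * θ' ^ (k + 1) < 1 := by
    calc 2 * θ' ^ (k + 1) ≤ 2 * θ' ^ k := by
          gcongr 2 * ?_
          exact pow_le_pow_right_of_le_one' hθ'1.le (Nat.le_succ k)
      _ ≤ 2 * (1 / 4) := by gcongr
      _ < 1 := by
          rw [← ENNReal.toReal_lt_toReal (by finiteness) (by finiteness)]
          norm_num
  have hsub : UqSym M b ⊆ (⋃ m : ℕ, {d | sh m d ∈ Rigid M b (k + 1)}) ∪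
      ⋃ p : ℕ × {A : List (Fin (M + 1)) // A.length = k + 1}, {d | sh p.1 d ∈ Recur M b p.2.1} := by
    intro d hd
    rcases exists_rigid_or_recur hb hbM (Nat.succ_le_succ (Nat.zero_le k)) hd with
      ⟨m, hm⟩ | ⟨m, A, hA, hm⟩
    · exact Or.inl (Set.mem_iUnion.2 ⟨m, hm⟩)
    · exact Or.inr (Set.mem_iUnion.2 ⟨(m, ⟨A, hA⟩), hm⟩)
  refine Null.mono (Null.union (Null.iUnion fun m => ?_) (Null.iUnion fun p => ?_)) hsub
  · exact (null_rigid hb hbM hθ'1.le hk').sh hθ'1 m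
  · refine (null_recur hb hbM ?_ hθ0 hθ1 hρ hθ hnull).sh hθ'1 p.1
    rw [p.2.2]; omega

/-! ### From univoque bases of `x` to smaller bases -/

lemma continuousOn_piQ {p : ℝ} (hp : 1 < p) (d : Digits M) :
    ContinuousOn (fun q => piQ M q d) (Set.Ici p) := by
  have hp0 : 0 < p := by linarith
  refine continuousOn_tsum (u := fun i => (d i : ℝ) / p ^ (i + 1)) (fun i => ?_)
    (summable_piQ hp d) (fun i q hq => ?_)
  · refine continuousOn_const.div (by fun_prop) fun q hq => ?_
    have : 0 < q := hp0.trans_le hq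
    positivity
  · have hq0 : 0 < q := hp0.trans_le hq
    rw [Real.norm_of_nonneg (by positivity)]
    have : p ≤ q := hq
    gcongr

lemma exists_base {p b x : ℝ} (hp : 1 < p) (hpb : p ≤ b) {d : Digits M} (h1 : x ≤ piQ M p d)
    (h2 : piQ M b d ≤ x) : ∃ q, p ≤ q ∧ q ≤ b ∧ piQ M q d = x := by
  have hc : ContinuousOn (fun q => piQ M q d) (Set.Icc p b) :=
    (continuousOn_piQ hp d).mono fun q hq => hq.1
  obtain ⟨q, hq, h⟩ := intermediate_value_Icc' hpb hc ⟨h2, h1⟩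
  exact ⟨q, hq.1, hq.2, h⟩

lemma piQ_zero (q : ℝ) : piQ M q (fun _ => 0) = 0 := by
  simp [piQ]

lemma piQ_last {q : ℝ} (hq : 1 < q) : piQ M q (fun _ => Fin.last M) = M / (q - 1) := by
  have := piQ_compl hq (fun _ => (0 : Fin (M + 1)))
  rw [piQ_zero, sub_zero] at this
  rw [← this]
  congr 1

lemma one_le_cast {a : Fin (M + 1)} (h : a ≠ 0) : (1 : ℝ) ≤ a := by
  exact_mod_cast Nat.one_le_iff_ne_zero.2 fun h' => h (Fin.ext h')

lemma piQ_ge_digit {q : ℝ} (hq : 1 < q) {d : Digits M} {i : ℕ} (h : d i ≠ 0) :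
    1 / q ^ (i + 1) ≤ piQ M q d := by
  have hq0 : 0 < q := by linarith
  refine le_trans ?_ ((summable_piQ hq d).le_tsum i fun j _ => by positivity)
  gcongr
  exact one_le_cast h

lemma piQ_sub_ge {p q : ℝ} (hp : 1 < p) (hpq : p ≤ q) {d : Digits M} {i : ℕ} (h : d i ≠ 0) :
    (q - p) / q ^ (i + 2) ≤ piQ M p d - piQ M q d := by
  have hp0 : 0 < p := by linarith
  have hq0 : 0 < q := by linarith
  have hq : 1 < q := by linarith
  have hle : ∀ j, (d j : ℝ) / q ^ (j + 1) ≤ (d j : ℝ) / p ^ (j + 1) := fun j => by gcongr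
  have hs := (summable_piQ hp d).sub (summable_piQ hq d)
  rw [piQ, piQ, ← (summable_piQ hp d).tsum_sub (summable_piQ hq d)]
  refine le_trans ?_ (hs.le_tsum i fun j _ => sub_nonneg.2 (hle j))
  have h1 : 1 / p ^ (i + 1) - 1 / q ^ (i + 1) ≤ (d i : ℝ) / p ^ (i + 1) - d i / q ^ (i + 1) := by
    have h0 : 1 / q ^ (i + 1) ≤ 1 / p ^ (i + 1) := by gcongr
    have := mul_le_mul_of_nonneg_right (one_le_cast h) (sub_nonneg.2 h0)
    calc _ = 1 * (1 / p ^ (i + 1) - 1 / q ^ (i + 1)) := by ring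
      _ ≤ _ := this
      _ = _ := by ring
  refine le_trans ?_ h1
  have hpow : p ^ (i + 1) ≤ p * q ^ i := by
    rw [pow_succ']; gcongr
  have h3 : (q - p) / q ^ (i + 2) ≤ (q - p) / (q * p ^ (i + 1)) := by
    have : q * p ^ (i + 1) ≤ q ^ (i + 2) := by
      rw [show i + 2 = (i + 1) + 1 by ring, pow_succ' q (i + 1)]; gcongr
    have h4 : 0 ≤ q - p := by linarith
    gcongr
  refine h3.trans ?_
  rw [div_sub_div _ _ (by positivity) (by positivity),
    div_le_div_iff₀ (by positivity) (by positivity)]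
  have hX : 0 < p ^ (i + 1) := by positivity
  have : (q - p) * q ^ (i + 1) ≤ q * (q ^ (i + 1) - p ^ (i + 1)) := by
    have := mul_le_mul_of_nonneg_left hpow hq0.le
    have e : q * (p * q ^ i) = p * q ^ (i + 1) := by ring
    nlinarith
  have := mul_le_mul_of_nonneg_right this hX.le
  nlinarith

lemma piQ_cat_eq {q : ℝ} (hq : 1 < q) (w : List (Fin (M + 1))) (y : Digits M) :
    piQ M q (cat w y) = piQ M q (cat w fun _ => 0) + piQ M q y / q ^ w.length := by
  have := piQ_cat_sub hq w y fun _ => 0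
  rw [piQ_zero, sub_zero] at this
  linarith

/-! #### The case `1 ≤ x` -/

lemma replicate_last_mem {q : ℝ} (hq : 1 < q) (hqM : q ≤ M + 1) {y : Digits M}
    (hy : y ∈ UqSym M q) (h1 : piQ M q (compl y) < 1) (N : ℕ) :
    cat (List.replicate N (Fin.last M)) y ∈ UqSym M q ∧
      piQ M q (compl (cat (List.replicate N (Fin.last M)) y)) < 1 := by
  induction N with
  | zero => exact ⟨hy, h1⟩
  | succ N ih =>
    rw [List.replicate_succ, cat_cons, cons_mem_UqSym hq hqM, compl_cons, piQ_cons hq]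
    refine ⟨⟨⟨fun h => absurd h (by simp), fun _ => ih.2⟩, ih.1⟩, ?_⟩
    rw [div_lt_one (by linarith)]
    simp only [Fin.rev_last, Fin.val_zero, Nat.cast_zero, zero_add]
    linarith [ih.2]

lemma null_UqSym_of_one_le {x : ℝ} (hx : 1 ≤ x) {θ : ℝ≥0∞} (h0 : θ ≠ 0) (h1 : θ < 1)
    (hnull : Null θ (UxSym M x)) {p : ℝ} (hp : 1 < p) (hpx : p < 1 + M / x) :
    Null θ (UqSym M p) := by
  have hx0 : 0 < x := by linarith
  have hbM : 1 + (M : ℝ) / x ≤ M + 1 := by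
    have : (M : ℝ) / x ≤ M := div_le_self (by positivity) hx
    linarith
  set b : ℝ := 1 + M / x with hb
  have hb1 : 1 < b := hp.trans hpx
  have hxb : (M : ℝ) / (b - 1) = x := by
    have : b - 1 = M / x := by rw [hb]; ring
    have hM0 : (M : ℝ) ≠ 0 := by
      rintro h
      rw [h, zero_div] at this
      linarith
    rw [this]
    field_simp
  have hpM : p ≤ M + 1 := hpx.le.trans hbM
  have hxp : x < M / (p - 1) := by
    rw [← hxb]
    have hMpos : (0 : ℝ) < M := by
      by_contra! h
      have h2 : (M : ℝ) = 0 := le_antisymm h (Nat.cast_nonneg M)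
      rw [h2] at hxb
      simp at hxb
      linarith
    have : 0 < p - 1 := by linarith
    gcongr
  obtain ⟨N, hN⟩ : ∃ N : ℕ, (M : ℝ) / (p - 1) / p ^ N < M / (p - 1) - x := by
    have hg : Filter.Tendsto (fun n : ℕ => (M : ℝ) / (p - 1) / p ^ n) Filter.atTop (nhds 0) :=
      Filter.Tendsto.div_atTop tendsto_const_nhds (tendsto_pow_atTop_atTop_of_one_lt hp)
    exact (hg.eventually (gt_mem_nhds (by linarith))).exists
  have hlast : ∀ n, cat (List.replicate n (Fin.last M)) (fun _ => Fin.last M) =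
      fun _ => Fin.last M := by
    intro n
    induction n with
    | zero => rfl
    | succ n ih =>
      rw [List.replicate_succ, cat_cons, ih]
      funext i; cases i <;> rfl
  have hsub : UqSym M p ⊆ (⋃ n, {d | sh (n + 1) d ∈
      {e | cat (List.replicate N (Fin.last M)) e ∈ UxSym M x}}) ∪ {fun _ => 0} := by
    intro d hd
    by_cases hz : ∃ n, d n ≠ 0
    · left
      obtain ⟨n, hn⟩ := hz
      refine Set.mem_iUnion.2 ⟨n, ?_⟩
      have hcond := ((mem_UqSym_iff hp hpM).1 hd n).2
        (Nat.pos_of_ne_zero fun h => hn (Fin.ext h))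
      have hmem := (replicate_last_mem hp hpM (sh_mem_UqSym hp hpM hd (n + 1)) hcond N).1
      set e := sh (n + 1) d
      set c := cat (List.replicate N (Fin.last M)) e with hc
      have hle : x ≤ piQ M p c := by
        have := piQ_cat_sub hp (List.replicate N (Fin.last M)) (fun _ => Fin.last M) e
        rw [hlast, piQ_last hp, List.length_replicate, ← hc] at this
        have hpe := piQ_nonneg hp e
        have : (M / (p - 1) - piQ M p e) / p ^ N ≤ M / (p - 1) / p ^ N := by
          have : 0 < p := by linarith
          gcongr
          linarith
        linarith
      obtain ⟨q, hq1, hq2, hq⟩ := exists_base hp hpx.le hle (hxb ▸ piQ_le hb1 c)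
      have hqM : q ≤ M + 1 := hq2.trans hbM
      exact mem_UxSym_of hx0 (hp.trans_le hq1) hqM (UqSym_mono hp hq1 hqM hmem) hq
    · right
      push Not at hz
      exact funext hz
  refine Null.mono (Null.union (Null.iUnion fun n => ?_) (null_singleton h1 _)) hsub
  exact (hnull.cat h0 h1 _).sh h1 (n + 1)

/-! #### The case `x < 1` -/

lemma exists_expansion_not_endsInZero (hM : 0 < M) {x : ℝ} (hx0 : 0 < x) (hx1 : x < 1) :
    ∃ a : Digits M, piQ M (M + 1) a = x ∧ ¬ EndsInZero a := by
  have hM' : (0 : ℝ) < M := by exact_mod_cast hM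
  have hb : (1 : ℝ) < M + 1 := by linarith
  have hmax : (M : ℝ) / ((M : ℝ) + 1 - 1) = 1 := by rw [add_sub_cancel_right, div_self hM'.ne']
  obtain ⟨e, he⟩ := exists_expansion hb le_rfl hx0.le (by rw [hmax]; exact hx1.le)
  by_cases hz : EndsInZero e
  swap
  · exact ⟨e, he, hz⟩
  have hspec := Nat.find_spec hz
  have hmin := fun n => Nat.find_min hz (m := n)
  obtain ⟨N, hN⟩ : ∃ N, Nat.find hz = N := ⟨_, rfl⟩
  rw [hN] at hspec hmin
  cases N with
  | zero =>
    have : e = fun _ => 0 := funext fun i => hspec i (Nat.zero_le i)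
    rw [this, piQ_zero] at he
    linarith
  | succ n =>
    have hn : e n ≠ 0 := by
      intro h
      refine hmin n (Nat.lt_succ_self n) fun i hi => ?_
      rcases hi.lt_or_eq with h' | rfl
      · exact hspec i h'
      · exact h
    have hn' : 0 < (e n : ℕ) := Nat.pos_of_ne_zero fun h => hn (Fin.ext h)
    have hlt : (e n : ℕ) - 1 < M + 1 := by have := (e n).2; omega
    refine ⟨cat (pre n e) (cons ⟨e n - 1, hlt⟩ fun _ => Fin.last M), ?_, ?_⟩
    · rw [← he]
      conv_rhs => rw [← cat_pre n e]
      rw [← sub_eq_zero, piQ_cat_sub hb, piQ_cons hb, piQ_last hb, hmax, piQ_eq_head hb (sh n e),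
        sh_sh]
      have h0 : sh (1 + n) e = fun _ => 0 := funext fun i => hspec _ (by omega)
      rw [h0, piQ_zero]
      simp [sh_apply, Nat.cast_sub (Nat.one_le_of_lt hn')]
    · rintro ⟨K, hK⟩
      have h1 := sh_cat (pre n e ++ [⟨e n - 1, hlt⟩]) fun _ => Fin.last M
      have h2 := congrFun h1 K
      rw [cat_append, cat_cons, cat_nil, sh_apply, hK _ (by omega)] at h2
      have := congrArg Fin.val h2
      simp at this
      omega

lemma mem_UxSym_of_prefix {x b p : ℝ} (hx : 0 < x) (hb : b = M + 1) (hp : 1 < p) (hpb : p < b)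
    {a e : Digits M} (ha : piQ M b a = x) (he : e ∈ UqSym M p) (he1 : piQ M p e < 1)
    (he0 : e 0 ≠ 0) {m l N : ℕ} (hm : a m ≠ 0) (hl : a l ≠ 0) (hN : a N ≠ 0) (hmN : m < N)
    (hlN : l < N) (h1 : b ^ (m + 2) ≤ b ^ N * (b - p)) (h2 : b ^ (m + 4) < b ^ l * (p - 1))
    (h3 : b ^ (m + l + 3) < b ^ N * (p - 1)) :
    cat (pre N a) (cons 0 e) ∈ UxSym M x := by
  have hb1 : 1 < b := hp.trans hpb
  have hb0 : 0 < b := by linarith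
  have hpM : p ≤ M + 1 := hb ▸ hpb.le
  have hmax : (M : ℝ) / (b - 1) = 1 := by
    rw [show b - 1 = M by rw [hb]; ring]
    refine div_self fun h => ?_
    rw [hb, h] at hb1
    linarith
  set c := cat (pre N a) (cons 0 e) with hc
  have hci : ∀ i < N, c i = a i := by
    intro i hi
    have := pre_cat_pre N a (cons 0 e)
    exact pre_eq_iff.1 this i hi
  have hxa : x - piQ M b c = (piQ M b (sh N a) - piQ M b (cons 0 e)) / b ^ N := by
    have := piQ_cat_sub hb1 (pre N a) (sh N a) (cons 0 e)
    rwa [cat_pre, ha, length_pre] at this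
  have hxN : x - piQ M b c ≤ 1 / b ^ N := by
    rw [hxa]
    have := piQ_le hb1 (sh N a)
    have := piQ_nonneg hb1 (cons 0 e)
    gcongr
    linarith
  have hcx : piQ M b c < x := by
    rw [← sub_pos, hxa]
    refine div_pos ?_ (by positivity)
    rw [piQ_cons hb1, piQ_eq_head hb1 (sh N a), ← sub_div]
    refine div_pos ?_ hb0
    have h4 := (piQ_antitone hp hpb.le e).trans_lt he1
    have h5 : (1 : ℝ) ≤ (sh N a 0 : ℕ) := by
      rw [sh_apply, zero_add]; exact one_le_cast hN
    have h6 := piQ_nonneg hb1 (sh 1 (sh N a))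
    simp only [Fin.val_zero, Nat.cast_zero]
    linarith
  have hpx : x ≤ piQ M p c := by
    have := piQ_sub_ge hp hpb.le (d := c) (i := m) (by rwa [hci m hmN])
    have h7 : 1 / b ^ N ≤ (b - p) / b ^ (m + 2) := by
      rw [div_le_div_iff₀ (by positivity) (by positivity)]; linarith
    linarith
  obtain ⟨q, hpq, hqb, hq⟩ := exists_base hp hpb.le hpx hcx.le
  have hqb' : q < b := lt_of_le_of_ne hqb fun h => by rw [h] at hq; linarith
  have hq1 : 1 < q := hp.trans_le hpq
  have hq0 : 0 < q := by linarith
  have hqM : q ≤ M + 1 := hb ▸ hqb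
  have hgap : (b - q) * b ^ N ≤ b ^ (m + 2) := by
    have h8 := piQ_sub_ge hq1 hqb (d := c) (i := m) (by rwa [hci m hmN])
    have : (b - q) / b ^ (m + 2) ≤ 1 / b ^ N := by linarith
    rw [div_le_div_iff₀ (by positivity) (by positivity)] at this
    linarith
  have he1q := (piQ_antitone hp hpq e).trans_lt he1
  refine mem_UxSym_of hx hq1 hqM ?_ hq
  rw [hc, cat_mem_UqSym hq1 hqM, cons_mem_UqSym hq1 hqM]
  refine ⟨fun r α s hs => ?_, ⟨fun _ => he1q, fun h => absurd h (by simp)⟩,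
    UqSym_mono hp hpq hqM he⟩
  set t := cat s (cons 0 e) with ht
  have hct : cat (r ++ [α]) t = c := by
    rw [hc, hs, show r ++ α :: s = (r ++ [α]) ++ s by simp, cat_append (r ++ [α]) s]
  have hlen : (r ++ [α]).length + s.length = N := by
    have := congrArg List.length hs
    simp at this ⊢
    omega
  set u := r ++ [α]
  have htc : sh u.length c = t := by rw [← hct, sh_cat]
  have hapre : pre u.length a = u := by
    have h9 : pre u.length a = pre u.length c :=
      pre_eq_iff.2 fun i hi => (hci i (by omega)).symm
    rw [h9, ← hct, pre_cat]
  constructor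
  · intro _
    have e1 := piQ_cat_eq hq1 u t
    rw [hct, hq] at e1
    have e2 := piQ_cat_eq hb1 u (sh u.length a)
    nth_rw 1 [← hapre] at e2
    rw [cat_pre, ha] at e2
    have e3 := piQ_antitone hq1 hqb (cat u fun _ => 0)
    have e4 := piQ_le hb1 (sh u.length a)
    rw [hmax] at e4
    have e5 : piQ M b (sh u.length a) / b ^ u.length ≤ 1 / b ^ u.length := by gcongr
    have hupos : u.length ≠ 0 := by simp [u]
    have e6 : 1 / b ^ u.length < 1 / q ^ u.length := by gcongr
    have e7 : piQ M q t / q ^ u.length < 1 / q ^ u.length := by linarith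
    exact (div_lt_div_iff_of_pos_right (by positivity)).1 e7
  · intro _
    have hMb : (M : ℝ) / (q - 1) - 1 = (b - q) / (q - 1) := by
      have : q - 1 ≠ 0 := by linarith
      rw [hb]; field_simp; ring
    suffices h : (b - q) / (q - 1) < piQ M q t by
      rw [piQ_compl hq1]; linarith
    obtain ⟨i, hti, hi⟩ : ∃ i, t i ≠ 0 ∧ b ^ (m + 2) * b ^ (i + 1) < b ^ N * (p - 1) := by
      rcases le_or_gt u.length l with h | h
      · refine ⟨l - u.length, ?_, ?_⟩
        · rw [← htc, sh_apply, show l - u.length + u.length = l by omega, hci l hlN]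
          exact hl
        · refine lt_of_le_of_lt ?_ h3
          rw [← pow_add]
          exact pow_le_pow_right₀ hb1.le (by omega)
      · refine ⟨s.length + 1, ?_, ?_⟩
        · have h10 : sh (s ++ [0]).length t = e := by
            rw [ht, show cat s (cons 0 e) = cat (s ++ [0]) e by rw [cat_append]; rfl, sh_cat]
          have h11 := congrFun h10 0
          rw [sh_apply] at h11
          simp only [List.length_append, List.length_cons, List.length_nil, zero_add] at h11
          rwa [h11]
        · have h12 : b ^ (m + 2) * b ^ (s.length + 1 + 1) * b ^ l ≤ b ^ N * b ^ (m + 4) := by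
            rw [← pow_add, ← pow_add, ← pow_add]
            exact pow_le_pow_right₀ hb1.le (by omega)
          have h13 : b ^ N * b ^ (m + 4) < b ^ N * (b ^ l * (p - 1)) := by gcongr
          have h14 : 0 < b ^ l := by positivity
          refine lt_of_mul_lt_mul_right (a := b ^ l) ?_ h14.le
          nlinarith
    refine lt_of_lt_of_le ?_ (piQ_ge_digit hq1 hti)
    have h15 : 1 / b ^ (i + 1) ≤ 1 / q ^ (i + 1) := by gcongr
    refine lt_of_lt_of_le ?_ h15
    rw [div_lt_div_iff₀ (by linarith) (by positivity), one_mul]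
    have h16 : 0 < b ^ N := by positivity
    refine lt_of_mul_lt_mul_left (a := b ^ N) ?_ h16.le
    have h17 : (b - q) * b ^ N * b ^ (i + 1) ≤ b ^ (m + 2) * b ^ (i + 1) := by gcongr
    have h18 : b ^ N * (p - 1) ≤ b ^ N * (q - 1) := by gcongr
    linarith

lemma null_UqSym_of_lt_one (hM : 0 < M) {x : ℝ} (hx0 : 0 < x) (hx1 : x < 1) {θ : ℝ≥0∞}
    (h0 : θ ≠ 0) (h1 : θ < 1) (hnull : Null θ (UxSym M x)) {p : ℝ} (hp : 1 < p)
    (hpb : p < M + 1) : Null θ (UqSym M p) := by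
  obtain ⟨a, ha, hinf⟩ := exists_expansion_not_endsInZero hM hx0 hx1
  have hinf' : ∀ n, ∃ i ≥ n, a i ≠ 0 := by
    intro n
    by_contra! h
    exact hinf ⟨n, h⟩
  obtain ⟨b, hb⟩ : ∃ b : ℝ, b = M + 1 := ⟨_, rfl⟩
  rw [← hb] at ha hpb
  have hb1 : 1 < b := hp.trans hpb
  have hlarge : ∀ K c : ℝ, 0 < c → ∀ᶠ n : ℕ in Filter.atTop, K < b ^ n * c := by
    intro K c hc
    exact ((tendsto_pow_atTop_atTop_of_one_lt hb1).atTop_mul_const hc).eventually_gt_atTop K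
  obtain ⟨m, -, hm⟩ := hinf' 0
  obtain ⟨l₀, hl₀⟩ := Filter.eventually_atTop.1 (hlarge (b ^ (m + 4)) (p - 1) (by linarith))
  obtain ⟨l, hll, hl⟩ := hinf' l₀
  obtain ⟨N₀, hN₀⟩ := Filter.eventually_atTop.1
    ((hlarge (b ^ (m + 2)) (b - p) (by linarith)).and
      ((hlarge (b ^ (m + l + 3)) (p - 1) (by linarith)).and
        ((Filter.eventually_gt_atTop m).and (Filter.eventually_gt_atTop l))))
  obtain ⟨N, hNN, hN⟩ := hinf' N₀
  obtain ⟨g1, g2, g3, g4⟩ := hN₀ N hNN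
  have hpM : p ≤ M + 1 := hb ▸ hpb.le
  have hsub : UqSym M p ⊆ (⋃ n, {d | sh (n + 1) d ∈
      {e | cat (pre N a ++ [0]) e ∈ UxSym M x}}) ∪
      ((⋃ n, {d | sh n d ∈ ({fun _ => 0} : Set (Digits M))}) ∪ {fun _ => Fin.last M}) := by
    intro d hd
    by_cases hz : ∃ n, (d n : ℕ) < M ∧ d (n + 1) ≠ 0
    · left
      obtain ⟨n, hn1, hn2⟩ := hz
      refine Set.mem_iUnion.2 ⟨n, ?_⟩
      have := mem_UxSym_of_prefix hx0 hb hp hpb ha (sh_mem_UqSym hp hpM hd (n + 1))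
        (((mem_UqSym_iff hp hpM).1 hd n).1 hn1) (by simpa [sh_apply] using hn2) hm hl hN g3 g4
        g1.le (hl₀ l hll) g2
      simpa [cat_append] using this
    · right
      push Not at hz
      by_cases hlast : ∃ n, (d n : ℕ) < M
      · left
        obtain ⟨n, hn⟩ := hlast
        refine Set.mem_iUnion.2 ⟨n + 1, ?_⟩
        have : ∀ i, d (i + (n + 1)) = 0 := by
          intro i
          induction i with
          | zero => simpa using hz n hn
          | succ i ih =>
            have := hz (i + (n + 1)) (by rw [ih]; simpa using hM)
            rwa [show i + 1 + (n + 1) = i + (n + 1) + 1 by ring]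
        exact funext this
      · right
        push Not at hlast
        refine funext fun i => Fin.ext ?_
        have := hlast i
        have := (d i).2
        simp; omega
  refine Null.mono (Null.union (Null.iUnion fun n => ?_)
    (Null.union (Null.iUnion fun n => ?_) (null_singleton h1 _))) hsub
  · exact (hnull.cat h0 h1 _).sh h1 (n + 1)
  · exact (null_singleton h1 _).sh h1 n

end

lemma null_UqSym_qx {M : ℕ} (hM : 0 < M) {x : ℝ} (hx : 0 < x) {t t' : ℝ≥0} (ht : 0 < t)
    (htt : t < t') (hnull : Null (ratio M ^ (t : ℝ)) (UxSym M x)) :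
    Null (ratio M ^ (t' : ℝ)) (UqSym M (qx M x)) := by
  have hM' : (0 : ℝ) < M := by exact_mod_cast hM
  have ht0 : (0 : ℝ) < t := ht
  have htt0 : (0 : ℝ) < t' - t := sub_pos.2 (by exact_mod_cast htt)
  have hq1 : 1 < qx M x := by
    refine lt_min (by linarith) ?_
    have : 0 < (M : ℝ) / x := by positivity
    linarith
  refine null_UqSym_of_lt hq1 (min_le_left _ _) weight_ne_zero (weight_lt_one hM ht0)
    (weight_lt_one hM htt0) ?_ fun p hp hpq => ?_
  · rw [← ENNReal.rpow_add _ _ ratio_ne_zero ratio_ne_top, sub_add_cancel]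
  · obtain ⟨h1, h2⟩ := lt_min_iff.1 hpq
    rcases le_or_gt 1 x with h | h
    · exact null_UqSym_of_one_le h weight_ne_zero (weight_lt_one hM ht0) hnull hp h2
    · exact null_UqSym_of_lt_one hM hx h weight_ne_zero (weight_lt_one hM ht0) hnull hp h1

/-- For every `x > 0`, `dim_H 𝐔(x) = dim_H 𝐔_{q_x}` (Hausdorff dimension on the sequence
space taken with respect to the metric `ρ`). -/
theorem dimH_UxSym_eq (M : ℕ) (hM : 0 < M) (x : ℝ) (hx : 0 < x) :
    gdimH (rho M) (UxSym M x) = gdimH (rho M) (UqSym M (qx M x)) :=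
  le_antisymm (dim_mono hM (UxSym_subset hx))
    (dim_mono_of_null hM fun _ _ ht htt h => null_UqSym_qx hM hx ht htt h)

end Expansions
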